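/- Let ℓ and p be distinct primes with ℓ ≡ p ≡ 1 (mod 4), and assume p is a primitive root modulo ℓ (the class of p generates (ℤ/ℓℤ)^×). Then for q = p^a with a ≥ 1, the curve H_ℓ is maximal over 𝔽_{q²} if and only if a = b·(ℓ−1)/2 for some odd positive integer b. -/

import Mathlib

open Polynomial

/-- Number of affine points (x,y) ∈ F × F with y² = φ_d(x), where φ_d is the
d-th Chebyshev (Dickson first kind, parameter 1) polynomial over F. -/
noncomputable def chebAffineCount (F : Type) [Field F] (d : ℕ) : ℕ :=
  Nat.card {xy : F × F // xy.2 ^ 2 = (dickson 1 (1 : F) d).eval xy.1}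

/-- The hyperelliptic curve H_d : y² = φ_d(x) is maximal over the field with q² elements:
its affine point count attains q² + (d-1)q (Hasse–Weil bound minus the point at infinity). -/
def chebMaximal (d q : ℕ) : Prop :=
  ∀ (F : Type) [Field F] [Fintype F], Fintype.card F = q ^ 2 →
    chebAffineCount F d = q ^ 2 + (d - 1) * q



/-! ### Digit sums -/

lemma cheb_geom (p n : ℕ) (hp : 1 < p) :
    (p - 1) * ∑ i ∈ Finset.range n, p ^ i = p ^ n - 1 := by
  have h := Nat.geomSum_eq (m := p) (by omega) n
  rw [h, Nat.mul_div_cancel']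
  simpa using Nat.sub_dvd_pow_sub_pow p 1 n

lemma cheb_digitsum_rep (p e n : ℕ) (hp : 1 < p) (he : e < p) :
    (Nat.digits p (e * ∑ i ∈ Finset.range n, p ^ i)).sum = n * e := by
  induction n with
  | zero => simp
  | succ n ih =>
    rcases Nat.eq_zero_or_pos e with h0 | h0
    · subst h0; simp
    have : e * ∑ i ∈ Finset.range (n + 1), p ^ i
        = e + p * (e * ∑ i ∈ Finset.range n, p ^ i) := by
      rw [Finset.sum_range_succ']
      simp only [pow_succ, ← Finset.sum_mul]
      ring
    rw [this, Nat.digits_add p hp _ _ he (Or.inl h0.ne'), List.sum_cons, ih]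
    ring

lemma cheb_digits_lower (p n : ℕ) (hp : 1 < p) (j : ℕ) :
    ∑ i ∈ Finset.range n, ((p ^ i * j) % (p ^ n - 1))
      ≤ (Nat.digits p j).sum * ∑ i ∈ Finset.range n, p ^ i := by
  induction j using Nat.strong_induction_on with
  | _ j ih =>
  rcases Nat.eq_zero_or_pos j with h0 | h0
  · subst h0; simp
  have hd : Nat.digits p j = (j % p) :: Nat.digits p (j / p) := Nat.digits_def' hp h0
  have ih' := ih (j / p) (Nat.div_lt_self h0 hp)
  have shift : ∑ i ∈ Finset.range n, ((p ^ i * (p * (j / p))) % (p ^ n - 1))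
      = ∑ i ∈ Finset.range n, ((p ^ i * (j / p)) % (p ^ n - 1)) := by
    have e1 := Finset.sum_range_succ (fun i => (p ^ i * (j / p)) % (p ^ n - 1)) n
    have e2 := Finset.sum_range_succ' (fun i => (p ^ i * (j / p)) % (p ^ n - 1)) n
    have e3 : (p ^ n * (j / p)) % (p ^ n - 1) = (p ^ 0 * (j / p)) % (p ^ n - 1) := by
      have hpn : p ^ n = (p ^ n - 1) + 1 := by
        have := Nat.one_le_pow n p (by omega); omega
      conv_lhs => rw [hpn]
      simp [add_mul]
    have e4 : ∑ i ∈ Finset.range n, ((p ^ i * (p * (j / p))) % (p ^ n - 1))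
        = ∑ i ∈ Finset.range n, ((p ^ (i + 1) * (j / p)) % (p ^ n - 1)) := by
      refine Finset.sum_congr rfl fun i _ => ?_
      rw [pow_succ, mul_assoc]
    omega
  rw [hd, List.sum_cons, add_mul]
  calc ∑ i ∈ Finset.range n, ((p ^ i * j) % (p ^ n - 1))
      ≤ ∑ i ∈ Finset.range n, ((j % p) * p ^ i + (p ^ i * (p * (j / p))) % (p ^ n - 1)) := by
        refine Finset.sum_le_sum fun i _ => ?_
        have : p ^ i * j = (j % p) * p ^ i + p ^ i * (p * (j / p)) := by
          conv_lhs => rw [← Nat.mod_add_div j p]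
          ring
        rw [this]
        rw [Nat.add_mod]
        exact (Nat.mod_le _ _).trans (Nat.add_le_add_right (Nat.mod_le _ _) _)
    _ = (j % p) * ∑ i ∈ Finset.range n, p ^ i
        + ∑ i ∈ Finset.range n, ((p ^ i * (j / p)) % (p ^ n - 1)) := by
        rw [Finset.sum_add_distrib, shift, Finset.mul_sum]
    _ ≤ _ := by
        exact Nat.add_le_add_left ih' _

lemma cheb_period (l p : ℕ) (hl : l.Prime) (hl4 : l % 4 = 1) (hp4 : p % 4 = 1)
    (hord : orderOf (p : ZMod l) = l - 1) (e : ℕ) (he : e % 2 = 1) (hle : ¬ l ∣ e) :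
    ∑ i ∈ Finset.range (l - 1), ((p ^ i * e) % (4 * l)) = 2 * l * (l - 1) := by
  have := Fact.mk hl
  have hl1 : 1 < l := hl.one_lt
  set c := e % 4 with hc
  have hc' : c = 1 ∨ c = 3 := by omega
  have hp0 : (p : ZMod l) ≠ 0 := by
    intro h
    rw [h] at hord
    have : orderOf (0 : ZMod l) = 0 := by
      rw [orderOf_eq_zero_iff']
      intro n hn; rw [zero_pow hn.ne']; exact zero_ne_one
    omega
  have he0 : (e : ZMod l) ≠ 0 := by
    rwa [Ne, ZMod.natCast_eq_zero_iff]
  have hinj : Set.InjOn (fun i => (p ^ i * e) % (4 * l)) (Finset.range (l - 1)) := by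
    intro i hi k hk hik
    simp only [Finset.coe_range, Set.mem_Iio] at hi hk
    have h1 : p ^ i * e ≡ p ^ k * e [MOD 4 * l] := hik
    have h2 : p ^ i * e ≡ p ^ k * e [MOD l] := h1.of_mul_left 4
    have h3 : ((p ^ i * e : ℕ) : ZMod l) = ((p ^ k * e : ℕ) : ZMod l) :=
      (ZMod.natCast_eq_natCast_iff _ _ _).2 h2
    push_cast at h3
    have h4 := mul_right_cancel₀ he0 h3
    exact pow_injOn_Iio_orderOf (by simpa [hord] using hi) (by simpa [hord] using hk) h4
  set T0 := (Finset.range l).image (fun m => c + 4 * m) with hT0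
  have hcard0 : T0.card = l := by
    rw [hT0, Finset.card_image_of_injective _ (fun x y h => by simpa using h), Finset.card_range]
  have hsum0 : ∑ x ∈ T0, x = c * l + 2 * l * (l - 1) := by
    rw [hT0, Finset.sum_image (fun x _ y _ h => by simpa using h), Finset.sum_add_distrib,
      ← Finset.mul_sum]
    have := Finset.sum_range_id_mul_two l
    simp only [Finset.sum_const, Finset.card_range, smul_eq_mul]
    nlinarith
  have hmem : c * l ∈ T0 := by
    rw [hT0, Finset.mem_image]
    refine ⟨c * (l / 4), ?_, ?_⟩
    · rw [Finset.mem_range]; rcases hc' with h | h <;> rw [h] <;> omega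
    · rcases hc' with h | h <;> rw [h] <;> omega
  have himg : (Finset.range (l - 1)).image (fun i => (p ^ i * e) % (4 * l)) = T0.erase (c * l) := by
    apply Finset.eq_of_subset_of_card_le
    · intro x hx
      obtain ⟨i, hi, rfl⟩ := Finset.mem_image.1 hx
      rw [Finset.mem_erase]
      constructor
      · intro h
        have : l ∣ p ^ i * e := by
          rw [← Nat.mod_add_div (p ^ i * e) (4 * l), h]
          exact dvd_add (dvd_mul_left _ _) (dvd_mul_of_dvd_left (dvd_mul_left _ _) _)
        have h5 : ((p ^ i * e : ℕ) : ZMod l) = 0 := (ZMod.natCast_eq_zero_iff _ _).2 this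
        push_cast at h5
        exact mul_ne_zero (pow_ne_zero _ hp0) he0 h5
      · rw [hT0, Finset.mem_image]
        have hmod : (p ^ i * e) % (4 * l) % 4 = c := by
          rw [Nat.mod_mul_right_mod, Nat.mul_mod, Nat.pow_mod, hp4]
          simp [hc]
        have hlt : (p ^ i * e) % (4 * l) < 4 * l := Nat.mod_lt _ (by omega)
        refine ⟨(p ^ i * e) % (4 * l) / 4, ?_, ?_⟩
        · rw [Finset.mem_range]; omega
        · omega
    · rw [Finset.card_erase_of_mem hmem, hcard0, Finset.card_image_of_injOn hinj, Finset.card_range]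
  have := Finset.sum_image (f := fun x : ℕ => x) hinj
  rw [himg] at this
  have h6 := Finset.sum_erase_add T0 (fun x : ℕ => x) hmem
  omega

lemma cheb_periods (l p : ℕ) (hl : l.Prime) (hl4 : l % 4 = 1) (hp4 : p % 4 = 1)
    (hord : orderOf (p : ZMod l) = l - 1) (e : ℕ) (he : e % 2 = 1) (hle : ¬ l ∣ e) (b : ℕ) :
    ∑ i ∈ Finset.range (b * (l - 1)), ((p ^ i * e) % (4 * l)) = b * (2 * l * (l - 1)) := by
  have := Fact.mk hl
  induction b with
  | zero => simp
  | succ b ih =>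
    rw [add_mul, one_mul, Finset.sum_range_add, ih, add_mul, one_mul]
    congr 1
    rw [← cheb_period l p hl hl4 hp4 hord (p ^ (b * (l - 1)) * e)]
    · refine Finset.sum_congr rfl fun i _ => ?_
      congr 1; ring
    · rw [Nat.mul_mod, Nat.pow_mod]
      have : p % 2 = 1 := by omega
      simp [this, he]
    · intro h
      rcases hl.dvd_mul.1 h with h | h
      · have h1 := hl.dvd_of_dvd_pow h
        have h2 : (p : ZMod l) = 0 := (ZMod.natCast_eq_zero_iff _ _).2 h1
        rw [h2] at hord
        have : orderOf (0 : ZMod l) = 0 := by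
          rw [orderOf_eq_zero_iff']
          intro n hn; rw [zero_pow hn.ne']; exact zero_ne_one
        have := hl.one_lt
        omega
      · exact hle h

lemma cheb_digit_ge (l p : ℕ) (hl : l.Prime) (hl4 : l % 4 = 1) (hp1 : 1 < p) (hp4 : p % 4 = 1)
    (hord : orderOf (p : ZMod l) = l - 1) (a b D : ℕ) (hab : 2 * a = b * (l - 1)) (ha : 1 ≤ a)
    (hD : p ^ (2 * a) - 1 = 4 * l * D)
    (e : ℕ) (he : e % 2 = 1) (hle : ¬ l ∣ e) :
    a * (p - 1) ≤ (Nat.digits p (D * e)).sum := by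
  have h1 := cheb_digits_lower p (2 * a) hp1 (D * e)
  have h2 : ∑ i ∈ Finset.range (2 * a), ((p ^ i * (D * e)) % (p ^ (2 * a) - 1))
      = D * (4 * l * a) := by
    have : 4 * l * a = b * (2 * l * (l - 1)) := by
      calc 4 * l * a = 2 * l * (2 * a) := by ring
        _ = _ := by rw [hab]; ring
    rw [this, ← cheb_periods l p hl hl4 hp4 hord e he hle b, hab, Finset.mul_sum]
    refine Finset.sum_congr rfl fun i _ => ?_
    rw [← Nat.mul_mod_mul_left, ← hab, hD]
    congr 1 <;> ring
  rw [h2] at h1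
  have h3 : (p - 1) * ∑ i ∈ Finset.range (2 * a), p ^ i = p ^ (2 * a) - 1 := by
    exact cheb_geom p _ hp1
  have hpos : 0 < ∑ i ∈ Finset.range (2 * a), p ^ i := by
    apply Finset.sum_pos (fun i _ => by positivity)
    simp; omega
  have h4 : D * (4 * l * a) = a * (p - 1) * ∑ i ∈ Finset.range (2 * a), p ^ i := by
    rw [mul_assoc a, h3, hD]; ring
  rw [h4] at h1
  exact Nat.le_of_mul_le_mul_right h1 hpos

lemma cheb_half (p n c e : ℕ) (hp : 1 < p) (hce : p - 1 = c * e) (hc : 0 < c) :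
    (p ^ n - 1) / c = e * ∑ i ∈ Finset.range n, p ^ i := by
  have h3 : (p - 1) * ∑ i ∈ Finset.range n, p ^ i = p ^ n - 1 := by
    exact cheb_geom p _ hp
  rw [← h3, hce, mul_assoc, Nat.mul_div_cancel_left _ hc]

lemma cheb_choose_dvd (l p : ℕ) (hl : l.Prime) (hl4 : l % 4 = 1) (hp : p.Prime) (hp4 : p % 4 = 1)
    (hord : orderOf (p : ZMod l) = l - 1) (a b : ℕ) (hab : 2 * a = b * (l - 1)) (ha : 1 ≤ a)
    (hlQ : l ∣ p ^ (2 * a) - 1) (j : ℕ)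
    (h1 : p ^ (2 * a) - 1 ∣ l * (p ^ a * ((p ^ (2 * a) - 1) / 2) + 2 * j))
    (h2 : ¬ p ^ (2 * a) - 1 ∣ (p ^ a * ((p ^ (2 * a) - 1) / 2) + 2 * j)) :
    p ^ a ∣ (p ^ a * ((p ^ (2 * a) - 1) / 2)).choose j := by
  have := Fact.mk hp
  have hp1 := hp.one_lt
  set M := p ^ a * ((p ^ (2 * a) - 1) / 2) with hM
  by_cases hjM : j ≤ M
  swap
  · rw [Nat.choose_eq_zero_of_lt (by omega)]; exact dvd_zero _
  have h4 : 4 ∣ p ^ (2 * a) - 1 := by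
    have : p ^ (2 * a) % 4 = 1 := by rw [Nat.pow_mod, hp4]; simp
    omega
  have hcop : Nat.Coprime 4 l := by
    rw [Nat.coprime_comm, Nat.Prime.coprime_iff_not_dvd hl]
    intro h
    have := Nat.le_of_dvd (by norm_num) h
    have := hl.one_lt
    interval_cases l <;> omega
  obtain ⟨D, hD⟩ := hcop.mul_dvd_of_dvd_of_dvd h4 hlQ
  have hQpos : 0 < p ^ (2 * a) - 1 := by
    have := Nat.one_lt_pow (show 2 * a ≠ 0 by omega) hp1
    omega
  have hDpos : 0 < D := by
    rcases Nat.eq_zero_or_pos D with h | h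
    · rw [h] at hD; omega
    · exact h
  have hM2 : M = p ^ a * (2 * l * D) := by
    rw [hM, hD]; congr 1
    rw [show 4 * l * D = 2 * (2 * l * D) by ring, Nat.mul_div_cancel_left _ (by norm_num)]
  have hpa : p ^ a % 2 = 1 := by
    have : p % 2 = 1 := by omega
    rw [Nat.pow_mod, this]; simp
  obtain ⟨e, hje, heodd⟩ : ∃ e, j = D * e ∧ e % 2 = 1 := by
    rw [hD, hM2, show 4 * l * D = l * (4 * D) by ring] at h1
    have h3 := Nat.dvd_of_mul_dvd_mul_left hl.pos h1
    obtain ⟨x, hx⟩ := h3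
    have h5 : D * (p ^ a * l) + j = D * (2 * x) := by linarith
    have h6 : D ∣ j := (Nat.dvd_add_right (dvd_mul_right D (p ^ a * l))).1 (h5 ▸ dvd_mul_right _ _)
    obtain ⟨e, rfl⟩ := h6
    refine ⟨e, rfl, ?_⟩
    rw [← mul_add] at h5
    have h7 := Nat.eq_of_mul_eq_mul_left hDpos h5
    have : (p ^ a * l) % 2 = 1 := by
      rw [Nat.mul_mod, hpa]; omega
    omega
  have hle : ¬ l ∣ e := by
    rintro ⟨f, rfl⟩
    apply h2
    have hf : f % 2 = 1 := by
      by_contra h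
      have : f % 2 = 0 := by omega
      rw [Nat.mul_mod, this] at heodd
      simp at heodd
    obtain ⟨g, hg⟩ : 2 ∣ p ^ a + f := by omega
    refine ⟨g, ?_⟩
    rw [hD, hM2, hje]
    calc p ^ a * (2 * l * D) + 2 * (D * (l * f)) = 2 * l * D * (p ^ a + f) := by ring
      _ = _ := by rw [hg]; ring
  have heM : e ≤ 2 * l * p ^ a := by
    rw [hM2, hje] at hjM
    have : D * e ≤ D * (2 * l * p ^ a) := by linarith
    exact Nat.le_of_mul_le_mul_left this hDpos
  have hMj : M - j = D * (2 * l * p ^ a - e) := by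
    rw [hM2, hje, Nat.mul_sub]; congr 1; ring
  have ge1 := cheb_digit_ge l p hl hl4 hp1 hp4 hord a b D hab ha hD e heodd hle
  have ge2 := cheb_digit_ge l p hl hl4 hp1 hp4 hord a b D hab ha hD (2 * l * p ^ a - e)
    (by
      have : (2 * l * p ^ a) % 2 = 0 := by rw [mul_assoc]; simp
      omega)
    (by
      intro h
      apply hle
      have := (Nat.dvd_sub_iff_right heM
        (show l ∣ 2 * l * p ^ a from dvd_mul_of_dvd_left (dvd_mul_left _ _) _)).1 h
      exact this)
  rw [← hje] at ge1
  rw [← hMj] at ge2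
  have hMs : (Nat.digits p M).sum = a * (p - 1) := by
    have hh : (p ^ (2 * a) - 1) / 2 = (p - 1) / 2 * ∑ i ∈ Finset.range (2 * a), p ^ i :=
      cheb_half p (2 * a) 2 _ hp1 (by omega) (by norm_num)
    rw [hM, Nat.digits_base_pow_mul hp1 (by omega), List.sum_append, hh,
      cheb_digitsum_rep p _ _ hp1 (by omega)]
    have : 2 * ((p - 1) / 2) = p - 1 := by omega
    simp only [List.sum_replicate, smul_eq_mul, mul_zero, zero_add]
    calc 2 * a * ((p - 1) / 2) = a * (2 * ((p - 1) / 2)) := by ring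
      _ = _ := by rw [this]
  have key := sub_one_mul_padicValNat_choose_eq_sub_sum_digits (p := p) hjM
  have h8 : (p - 1) * a ≤ (p - 1) * padicValNat p (M.choose j) := by
    rw [key, hMs]
    rw [mul_comm a] at *
    omega
  have h9 := Nat.le_of_mul_le_mul_left h8 (by omega)
  exact (pow_dvd_pow p h9).trans pow_padicValNat_dvd

lemma cheb_choose_not_dvd (p n : ℕ) (hp : p.Prime) (hp4 : p % 4 = 1) :
    ¬ p ∣ ((p ^ n - 1) / 2).choose ((p ^ n - 1) / 4) := by
  have := Fact.mk hp
  have hp1 := hp.one_lt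
  have h2 := cheb_half p n 2 ((p - 1) / 2) hp1 (by omega) (by norm_num)
  have h4 := cheb_half p n 4 ((p - 1) / 4) hp1 (by omega) (by norm_num)
  have hle : (p ^ n - 1) / 4 ≤ (p ^ n - 1) / 2 := by omega
  have hsub : (p ^ n - 1) / 2 - (p ^ n - 1) / 4 = (p ^ n - 1) / 4 := by
    have : (p ^ n) % 4 = 1 := by rw [Nat.pow_mod, hp4]; simp
    omega
  have key := sub_one_mul_padicValNat_choose_eq_sub_sum_digits (p := p) hle
  rw [hsub, h2, h4, cheb_digitsum_rep p _ _ hp1 (by omega),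
    cheb_digitsum_rep p _ _ hp1 (by omega), ← h2, ← h4] at key
  have : n * ((p - 1) / 4) + n * ((p - 1) / 4) = n * ((p - 1) / 2) := by
    rw [← mul_add]; congr 1; omega
  rw [this, Nat.sub_self] at key
  have h0 : padicValNat p (((p ^ n - 1) / 2).choose ((p ^ n - 1) / 4)) = 0 := by
    rcases Nat.mul_eq_zero.1 key with h | h
    · omega
    · exact h
  rcases padicValNat.eq_zero_iff.1 h0 with h | h | h
  · omega
  · exact absurd h (Nat.choose_pos hle).ne'
  · exact h

/-! ### The sums over the multiplicative group -/

/-- The sum of the quadratic character of `t ^ d + t ^ (-d)` over the units of `F`. -/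
noncomputable def chebA (F : Type) [Field F] [Fintype F] [DecidableEq F] (d : ℕ) : ℤ :=
  ∑ t : Fˣ, quadraticChar F ((t : F) ^ d + ((t⁻¹ : Fˣ) : F) ^ d)

section
variable {F : Type} [Field F] [Fintype F] [DecidableEq F]

lemma cheb_term_eq (d : ℕ) (hd : Odd d) (t : Fˣ) :
    quadraticChar F ((t : F) ^ d + ((t⁻¹ : Fˣ) : F) ^ d)
      = quadraticChar F (t : F) * quadraticChar F (1 + (t : F) ^ (2 * d)) := by
  have ht : (t : F) ≠ 0 := t.ne_zero
  obtain ⟨k, rfl⟩ := hd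
  have : (t : F) ^ (2 * k + 1) + ((t⁻¹ : Fˣ) : F) ^ (2 * k + 1)
      = ((t : F) * ((t : F) ^ (k + 1))⁻¹ ^ 2) * (1 + (t : F) ^ (2 * (2 * k + 1))) := by
    rw [Units.val_inv_eq_inv_val, inv_pow]
    field_simp
    ring
  rw [this, map_mul, map_mul, quadraticChar_sq_one' (inv_ne_zero (pow_ne_zero _ ht)), mul_one]

lemma chebA_eq (d : ℕ) (hd : Odd d) :
    chebA F d = ∑ t : Fˣ, quadraticChar F (t : F) * quadraticChar F (1 + (t : F) ^ (2 * d)) :=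
  Finset.sum_congr rfl fun t _ => cheb_term_eq d hd t

lemma cheb_charF (p n : ℕ) (hp : p.Prime) (hn : n ≠ 0) (hcard : Fintype.card F = p ^ n) :
    CharP F p := by
  have := Fact.mk hp
  obtain ⟨r, hr⟩ := CharP.exists F
  have hr' : r.Prime := by
    have := CharP.char_is_prime F r; exact this
  obtain ⟨m, hm, h2⟩ := FiniteField.card F r
  have : r = p := by
    rw [hcard] at h2
    have h3 : r ∣ p ^ n := by rw [h2]; exact dvd_pow_self _ m.ne_zero
    exact (Nat.prime_dvd_prime_iff_eq hr' hp).1 (hr'.dvd_of_dvd_pow h3)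
  rwa [← this]

lemma chebA_one_not_dvd (p n : ℕ) (hp : p.Prime) (hp4 : p % 4 = 1) (hn : n ≠ 0)
    (hcard : Fintype.card F = p ^ n) : ¬ (p : ℤ) ∣ chebA F 1 := by
  have := cheb_charF p n hp hn hcard
  have hF2 : ringChar F ≠ 2 := by rw [ringChar.eq F p]; rintro rfl; omega
  have hQ4 : p ^ n % 4 = 1 := by rw [Nat.pow_mod, hp4]; simp
  have hQ1 : 1 < p ^ n := Nat.one_lt_pow hn hp.one_lt
  rw [← CharP.intCast_eq_zero_iff F p, chebA_eq 1 odd_one]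
  push_cast
  have hh : Fintype.card F / 2 = (p ^ n - 1) / 2 := by rw [hcard]; omega
  simp only [quadraticChar_eq_pow_of_char_ne_two' hF2, hh]
  set h := (p ^ n - 1) / 2 with hhdef
  have e1 : ∀ t : Fˣ, (t : F) ^ h * (1 + (t : F) ^ (2 * 1)) ^ h
      = ∑ j ∈ Finset.range (h + 1), (h.choose j : F) * (t : F) ^ (h + 2 * j) := by
    intro t
    rw [add_comm, add_pow, Finset.mul_sum]
    refine Finset.sum_congr rfl fun j _ => ?_
    rw [one_pow]; ring
  simp only [e1]
  rw [Finset.sum_comm]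
  simp only [← Finset.mul_sum]
  have e2 : ∀ j ∈ Finset.range (h + 1),
      (h.choose j : F) * ∑ t : Fˣ, (t : F) ^ (h + 2 * j)
      = if j = (p ^ n - 1) / 4 then -(h.choose ((p ^ n - 1) / 4) : F) else 0 := by
    intro j hj
    rw [FiniteField.sum_pow_units, hcard]
    have hj' : j ≤ h := by simpa [Nat.lt_succ_iff] using hj
    have hiff : p ^ n - 1 ∣ h + 2 * j ↔ j = (p ^ n - 1) / 4 := by
      have h2 : p ^ n - 1 = 2 * h := by omega
      rw [h2]
      constructor
      · rintro ⟨c, hc⟩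
        have : c = 1 := by
          have hpos : 0 < h := by omega
          have hlt : c < 2 := by
            by_contra hcon
            have : 2 * h * 2 ≤ 2 * h * c := Nat.mul_le_mul_left _ (by omega)
            omega
          have hc0 : c ≠ 0 := by rintro rfl; omega
          omega
        subst this; omega
      · intro hj; refine ⟨1, ?_⟩; omega
    by_cases hc : j = (p ^ n - 1) / 4
    · rw [if_pos (hiff.2 hc), if_pos hc, hc]; ring
    · rw [if_neg (fun hx => hc (hiff.1 hx)), if_neg hc, mul_zero]
  rw [Finset.sum_congr rfl e2, Finset.sum_ite_eq', if_pos (by rw [Finset.mem_range]; omega),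
    neg_eq_zero, CharP.cast_eq_zero_iff F p]
  exact cheb_choose_not_dvd p n hp hp4

lemma cheb_witt_sum (p n : ℕ) [Fact p.Prime] [CharP F p] (hcard : Fintype.card F = p ^ n) (i : ℕ) :
    ∑ t : Fˣ, (WittVector.teichmuller p (t : F)) ^ i
      = if p ^ n - 1 ∣ i then ((p ^ n - 1 : ℕ) : WittVector p F) else 0 := by
  let f : Fˣ →* WittVector p F :=
    { toFun := fun x => (WittVector.teichmuller p (x : F)) ^ i
      map_one' := by simp
      map_mul' := by simp [mul_pow] }
  have hf : f = 1 ↔ p ^ n - 1 ∣ i := by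
    rw [← hcard, ← FiniteField.forall_pow_eq_one_iff, MonoidHom.ext_iff]
    refine forall_congr' fun x => ?_
    constructor
    · intro h
      have h1 : (WittVector.teichmuller p ((x : F) ^ i)) = WittVector.teichmuller p 1 := by
        rw [map_pow, map_one]; exact h
      have h2 := congrArg (fun w => WittVector.coeff w 0) h1
      simp only [WittVector.teichmuller_coeff_zero] at h2
      ext; simpa using h2
    · intro h
      change (WittVector.teichmuller p (x : F)) ^ i = 1
      rw [← map_pow, ← Units.val_pow_eq_pow_val, h]; simp
  classical
  have := sum_hom_units f
  rw [Fintype.card_units, hcard] at this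
  simp only [hf] at this
  rw [← Nat.cast_zero, ← Nat.cast_ite] at *
  exact this

lemma cheb_witt_chi (p n a : ℕ) [Fact p.Prime] [CharP F p] (hp2 : p % 2 = 1)
    (hcard : Fintype.card F = p ^ n) (w : WittVector p F) :
    (p : WittVector p F) ^ a ∣ ((quadraticChar F (w.coeff 0) : ℤ) : WittVector p F)
      - w ^ (p ^ a * ((p ^ n - 1) / 2)) := by
  have hF2 : ringChar F ≠ 2 := by rw [ringChar.eq F p]; rintro rfl; omega
  have hodd : p ^ n % 2 = 1 := by rw [Nat.pow_mod, hp2]; simp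
  have h1 : (p : WittVector p F) ∣ ((quadraticChar F (w.coeff 0) : ℤ) : WittVector p F)
      - w ^ ((p ^ n - 1) / 2) := by
    rw [← Ideal.mem_span_singleton, WittVector.mem_span_p_iff_coeff_zero_eq_zero]
    rw [← WittVector.constantCoeff_apply]
    rw [map_sub, map_intCast, map_pow, quadraticChar_eq_pow_of_char_ne_two' hF2, hcard]
    have : p ^ n / 2 = (p ^ n - 1) / 2 := by omega
    rw [this]
    exact sub_self _
  have h2 := dvd_sub_pow_of_dvd_sub h1 a
  have h3 : ((quadraticChar F (w.coeff 0) : ℤ) : WittVector p F) ^ p ^ a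
      = ((quadraticChar F (w.coeff 0) : ℤ) : WittVector p F) := by
    have hpa : Odd (p ^ a) := (Nat.odd_iff.2 hp2).pow
    rcases quadraticChar_isQuadratic F (w.coeff 0) with h | h | h <;> rw [h]
    · rw [Int.cast_zero, zero_pow hpa.pos.ne']
    · simp
    · push_cast; rw [hpa.neg_one_pow]
  rw [h3, ← pow_mul, mul_comm ((p ^ n - 1) / 2)] at h2
  exact (pow_dvd_pow _ (Nat.le_succ a)).trans h2

lemma cheb_witt_A (p n a d : ℕ) [Fact p.Prime] [CharP F p] (hp2 : p % 2 = 1) (hd : Odd d)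
    (hcard : Fintype.card F = p ^ n) (M : ℕ) (hM : M = p ^ a * ((p ^ n - 1) / 2)) :
    (p : WittVector p F) ^ a ∣ ((chebA F d : ℤ) : WittVector p F)
      - ∑ j ∈ Finset.range (M + 1), (M.choose j : WittVector p F) *
        if p ^ n - 1 ∣ d * (M + 2 * j) then ((p ^ n - 1 : ℕ) : WittVector p F) else 0 := by
  have e1 : ∑ j ∈ Finset.range (M + 1), (M.choose j : WittVector p F) *
        (if p ^ n - 1 ∣ d * (M + 2 * j) then ((p ^ n - 1 : ℕ) : WittVector p F) else 0)
      = ∑ t : Fˣ, (WittVector.teichmuller p (t : F) ^ d *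
          (1 + WittVector.teichmuller p (t : F) ^ (2 * d))) ^ M := by
    simp only [← cheb_witt_sum p n hcard, Finset.mul_sum]
    rw [Finset.sum_comm]
    refine Finset.sum_congr rfl fun t _ => ?_
    rw [mul_pow, add_comm 1, add_pow, Finset.mul_sum]
    refine Finset.sum_congr rfl fun j _ => ?_
    rw [one_pow]; ring
  rw [e1, chebA_eq d hd, Int.cast_sum, ← Finset.sum_sub_distrib]
  refine Finset.dvd_sum fun t _ => ?_
  have := cheb_witt_chi p n a hp2 hcard (WittVector.teichmuller p (t : F) ^ d *
          (1 + WittVector.teichmuller p (t : F) ^ (2 * d)))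
  rw [← hM] at this
  have h2 : (WittVector.teichmuller p (t : F) ^ d *
          (1 + WittVector.teichmuller p (t : F) ^ (2 * d))).coeff 0
      = (t : F) ^ d * (1 + (t : F) ^ (2 * d)) := by
    rw [← WittVector.constantCoeff_apply]
    rw [map_mul, map_add, map_pow, map_pow, map_one]
    have : WittVector.constantCoeff (WittVector.teichmuller p (t : F)) = (t : F) :=
      WittVector.teichmuller_coeff_zero p _
    rw [this]
  rw [h2] at this
  have h3 : quadraticChar F ((t : F) ^ d * (1 + (t : F) ^ (2 * d)))
      = quadraticChar F (t : F) * quadraticChar F (1 + (t : F) ^ (2 * d)) := by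
    rw [map_mul]; congr 1
    obtain ⟨k, rfl⟩ := hd
    rw [pow_succ, pow_mul', map_mul, quadraticChar_sq_one' (pow_ne_zero _ t.ne_zero), one_mul]
  rwa [h3] at this

lemma cheb_dvd_diff (l p : ℕ) (hl : l.Prime) (hl4 : l % 4 = 1) (hp : p.Prime) (hp4 : p % 4 = 1)
    (hord : orderOf (p : ZMod l) = l - 1) (a b : ℕ) (hab : 2 * a = b * (l - 1)) (ha : 1 ≤ a)
    (hlQ : l ∣ p ^ (2 * a) - 1) (hcard : Fintype.card F = p ^ (2 * a)) :
    (p : ℤ) ^ a ∣ chebA F l - chebA F 1 := by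
  have := Fact.mk hp
  have := cheb_charF p (2 * a) hp (by omega) hcard
  have hlodd : Odd l := Nat.odd_iff.2 (by omega)
  have h1 := cheb_witt_A (F := F) p (2 * a) a l (by omega) hlodd hcard _ rfl
  have h2 := cheb_witt_A (F := F) p (2 * a) a 1 (by omega) odd_one hcard _ rfl
  set M := p ^ a * ((p ^ (2 * a) - 1) / 2) with hM
  have h3 : (p : WittVector p F) ^ a ∣ (∑ j ∈ Finset.range (M + 1), (M.choose j : WittVector p F) *
        if p ^ (2 * a) - 1 ∣ l * (M + 2 * j) then ((p ^ (2 * a) - 1 : ℕ) : WittVector p F) else 0)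
      - (∑ j ∈ Finset.range (M + 1), (M.choose j : WittVector p F) *
        if p ^ (2 * a) - 1 ∣ 1 * (M + 2 * j) then ((p ^ (2 * a) - 1 : ℕ) : WittVector p F) else 0) := by
    rw [← Finset.sum_sub_distrib]
    refine Finset.dvd_sum fun j _ => ?_
    rw [one_mul]
    by_cases c1 : p ^ (2 * a) - 1 ∣ M + 2 * j
    · rw [if_pos c1, if_pos (dvd_mul_of_dvd_right c1 _), sub_self]; exact dvd_zero _
    · rw [if_neg c1, mul_zero, sub_zero]
      split_ifs with c2
      · have := cheb_choose_dvd l p hl hl4 hp hp4 hord a b hab ha hlQ j c2 c1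
        have h4 : ((p ^ a : ℕ) : WittVector p F) ∣ (M.choose j : WittVector p F) :=
          Nat.cast_dvd_cast this
        push_cast at h4
        exact dvd_mul_of_dvd_left h4 _
      · simp
  have h4 : (p : WittVector p F) ^ a ∣ ((chebA F l - chebA F 1 : ℤ) : WittVector p F) := by
    have := dvd_add (dvd_sub h1 h2) h3
    push_cast
    convert this using 1
    ring
  -- descend to the integers
  have key : ∀ (k : ℕ) (z : ℤ), (p : WittVector p F) ^ k ∣ (z : WittVector p F) → (p : ℤ) ^ k ∣ z := by
    intro k
    induction k with
    | zero => intro z _; simp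
    | succ k ih =>
      intro z hz
      have hp1 : (p : WittVector p F) ∣ (z : WittVector p F) :=
        (dvd_pow_self _ (Nat.succ_ne_zero k)).trans hz
      have hz0 : (p : ℤ) ∣ z := by
        rw [← CharP.intCast_eq_zero_iff F p]
        obtain ⟨w, hw⟩ := hp1
        have := congrArg (WittVector.constantCoeff (p := p) (R := F)) hw
        rw [map_intCast, map_mul, map_natCast, CharP.cast_eq_zero, zero_mul] at this
        exact this
      obtain ⟨y, rfl⟩ := hz0
      push_cast at hz
      rw [pow_succ'] at hz ⊢
      exact mul_dvd_mul_left _ (ih y ((mul_dvd_mul_iff_left (WittVector.p_nonzero p F)).1 hz))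
  exact key a _ h4

end

lemma cheb_grp {G : Type*} [CommGroup G] [Fintype G] (f : G → ℤ) (l : ℕ) (hl : l.Prime) :
    (¬ l ∣ Fintype.card G → ∑ t : G, f (t ^ l) = ∑ t : G, f t) ∧
    (l ∣ Fintype.card G → (l : ℤ) ∣ ∑ t : G, f (t ^ l)) := by
  classical
  constructor
  · intro h
    have hc : (Nat.card G).Coprime l := by
      rw [Nat.card_eq_fintype_card]
      exact ((Nat.Prime.coprime_iff_not_dvd hl).mpr h).symm
    have hb : Function.Bijective (fun t : G => t ^ l) := hc.pow_left_bijective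
    exact Fintype.sum_bijective _ hb _ _ (fun t => rfl)
  · intro h
    haveI := Fact.mk hl
    obtain ⟨g, hg⟩ := exists_prime_orderOf_dvd_card l h
    have hker : l ∣ (Finset.univ.filter (fun a : G => a ^ l = 1)).card := by
      let H : Subgroup G := (powMonoidHom l : G →* G).ker
      have h1 : orderOf (⟨g, by
          simp only [H, MonoidHom.mem_ker, powMonoidHom_apply]
          rw [← hg]; exact pow_orderOf_eq_one g⟩ : H) = l := by
        rw [Subgroup.orderOf_mk]; exact hg
      have h2 : l ∣ Nat.card H := by
        conv_lhs => rw [← h1]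
        exact orderOf_dvd_natCard _
      have h3 : Nat.card H = (Finset.univ.filter (fun a : G => a ^ l = 1)).card := by
        rw [Nat.card_eq_fintype_card, Fintype.card_subtype]
        congr 1
        ext x
        simp [H, MonoidHom.mem_ker]
      rwa [h3] at h2
    have := Finset.sum_comp (s := (Finset.univ : Finset G)) f (fun t : G => t ^ l)
    rw [this]
    apply Finset.dvd_sum
    intro b hb
    have h4 : (Finset.univ.filter (fun a : G => a ^ l = b)).card =
        (Finset.univ.filter (fun a : G => a ^ l = 1)).card := by
      have := MonoidHom.card_fiber_eq_of_mem_range (powMonoidHom l : G →* G) (x := b) (y := 1)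
        (by simpa using hb) ⟨1, by simp⟩
      simpa using this
    rw [h4, nsmul_eq_mul]
    exact Dvd.dvd.mul_right (by exact_mod_cast hker) _

section part3
variable {F : Type} [Field F] [Fintype F] [DecidableEq F]

lemma cheb_count (hF : ringChar F ≠ 2) (d : ℕ) :
    (chebAffineCount F d : ℤ) = Fintype.card F +
      ∑ x : F, quadraticChar F ((dickson 1 (1 : F) d).eval x) := by
  classical
  have h1 : chebAffineCount F d =
      ∑ x : F, Fintype.card {y : F // y ^ 2 = (dickson 1 (1 : F) d).eval x} := by
    unfold chebAffineCount
    rw [Nat.card_eq_fintype_card, ← Fintype.card_sigma]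
    exact Fintype.card_congr
      { toFun := fun z => ⟨z.1.1, z.1.2, z.2⟩
        invFun := fun z => ⟨(z.1, z.2.1), z.2.2⟩
        left_inv := fun z => rfl
        right_inv := fun z => rfl }
  rw [h1]
  push_cast
  have h2 : ∀ x : F, ((Fintype.card {y : F // y ^ 2 = (dickson 1 (1 : F) d).eval x} : ℕ) : ℤ) =
      1 + quadraticChar F ((dickson 1 (1 : F) d).eval x) := by
    intro x
    rw [add_comm, ← quadraticChar_card_sqrts hF]
    rw [Set.toFinset_card]
    norm_cast
  simp_rw [h2]
  rw [Finset.sum_add_distrib]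
  simp

lemma cheb_mem_range (z : AlgebraicClosure F) (hz : z ^ Fintype.card F = z) :
    ∃ x : F, algebraMap F (AlgebraicClosure F) x = z := by
  classical
  have hQ : 1 < Fintype.card F := Fintype.one_lt_card
  have hne : (X ^ Fintype.card F - X : (AlgebraicClosure F)[X]) ≠ 0 :=
    FiniteField.X_pow_card_sub_X_ne_zero _ hQ
  have hsub : Finset.univ.image (algebraMap F (AlgebraicClosure F)) ⊆
      (X ^ Fintype.card F - X : (AlgebraicClosure F)[X]).roots.toFinset := by
    intro y hy
    obtain ⟨x, -, rfl⟩ := Finset.mem_image.mp hy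
    rw [Multiset.mem_toFinset, mem_roots hne]
    simp [IsRoot, ← map_pow, FiniteField.pow_card]
  have hcard : (X ^ Fintype.card F - X : (AlgebraicClosure F)[X]).roots.toFinset.card ≤
      (Finset.univ.image (algebraMap F (AlgebraicClosure F))).card := by
    rw [Finset.card_image_of_injective _ (algebraMap F (AlgebraicClosure F)).injective]
    refine (Multiset.toFinset_card_le _).trans ((card_roots' _).trans ?_)
    rw [FiniteField.X_pow_card_sub_X_natDegree_eq _ hQ]
    simp
  have heq := Finset.eq_of_subset_of_card_le hsub hcard
  have hz' : z ∈ (X ^ Fintype.card F - X : (AlgebraicClosure F)[X]).roots.toFinset := by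
    rw [Multiset.mem_toFinset, mem_roots hne]
    simp [IsRoot, hz]
  rw [← heq] at hz'
  obtain ⟨x, -, hx⟩ := Finset.mem_image.mp hz'
  exact ⟨x, hx⟩

lemma cheb_add_inv_eq {K : Type*} [Field K] {s t : K} (hs : s ≠ 0) (ht : t ≠ 0)
    (h : s + s⁻¹ = t + t⁻¹) : s = t ∨ s = t⁻¹ := by
  have h1 : (s - t) * (s * t - 1) = 0 := by
    field_simp at h
    linear_combination h
  rcases mul_eq_zero.mp h1 with h2 | h2
  · left; exact sub_eq_zero.mp h2
  · right; exact eq_inv_of_mul_eq_one_left (sub_eq_zero.mp h2)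

lemma cheb_fib {K : Type*} [Field K] [DecidableEq K] {G : Type*} [CommGroup G] [Fintype G]
    [DecidableEq G]
    (i : G →* Kˣ) (hi : Function.Injective i) (x : K) (t : G)
    (ht : (i t : K) + (i t : K)⁻¹ = x) :
    Finset.univ.filter (fun s : G => (i s : K) + (i s : K)⁻¹ = x) ⊆ {t, t⁻¹} := by
  intro s hs
  simp only [Finset.mem_filter, Finset.mem_univ, true_and] at hs
  rw [Finset.mem_insert, Finset.mem_singleton]
  rcases cheb_add_inv_eq (i s).ne_zero (i t).ne_zero (hs.trans ht.symm) with h | h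
  · left; exact hi (Units.ext h)
  · right
    apply hi
    rw [map_inv]
    apply Units.ext
    rw [h, Units.val_inv_eq_inv_val]

lemma cheb_sum_fib {G : Type*} [Fintype G] (g : G → F) (f : F → ℤ) :
    ∑ t : G, f (g t) = ∑ x : F, ((Finset.univ.filter (fun t : G => g t = x)).card : ℤ) * f x := by
  simp_rw [Finset.card_filter]
  push_cast
  simp_rw [Finset.sum_mul]
  rw [Finset.sum_comm]
  apply Finset.sum_congr rfl
  intro t _
  simp

lemma cheb_fib_two {K : Type*} [Field K] [DecidableEq K] {G H : Type*} [CommGroup G] [Fintype G]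
    [CommGroup H] [Fintype H]
    (i : G →* Kˣ) (hi : Function.Injective i) (j : H →* Kˣ) (hj : Function.Injective j)
    (hij : ∀ (s : G) (t : H), i s = j t → i s ^ 2 = 1) (x : K) :
    (Finset.univ.filter (fun s : G => (i s : K) + (i s : K)⁻¹ = x)).card +
    (Finset.univ.filter (fun s : H => (j s : K) + (j s : K)⁻¹ = x)).card ≤ 2 := by
  classical
  by_cases h1 : ∃ s : G, (i s : K) + (i s : K)⁻¹ = x
  · obtain ⟨s, hs⟩ := h1
    have hs' := cheb_fib i hi x s hs
    by_cases h2 : ∃ t : H, (j t : K) + (j t : K)⁻¹ = x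
    · obtain ⟨t, ht⟩ := h2
      have ht' := cheb_fib j hj x t ht
      have h3 : i s ^ 2 = 1 := by
        rcases cheb_add_inv_eq (i s).ne_zero (j t).ne_zero (hs.trans ht.symm) with h | h
        · exact hij s t (Units.ext h)
        · exact hij s t⁻¹ (by
            rw [map_inv]; apply Units.ext; rw [h, Units.val_inv_eq_inv_val])
      have h4 : j t ^ 2 = 1 := by
        rcases cheb_add_inv_eq (i s).ne_zero (j t).ne_zero (hs.trans ht.symm) with h | h
        · rw [← h3]; congr 1; exact (Units.ext h).symm
        · have : i s = (j t)⁻¹ := by apply Units.ext; rw [h, Units.val_inv_eq_inv_val]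
          rw [this, inv_pow, inv_eq_one] at h3
          exact h3
      have h5 : s⁻¹ = s := by
        apply hi
        rw [map_inv]
        exact inv_eq_of_mul_eq_one_left (by rw [← sq, h3])
      have h6 : t⁻¹ = t := by
        apply hj
        rw [map_inv]
        exact inv_eq_of_mul_eq_one_left (by rw [← sq, h4])
      rw [h5, Finset.pair_eq_singleton] at hs'
      rw [h6, Finset.pair_eq_singleton] at ht'
      have := Finset.card_le_card hs'
      have := Finset.card_le_card ht'
      rw [Finset.card_singleton] at *
      omega
    · rw [Finset.filter_eq_empty_iff.mpr (fun t _ h => h2 ⟨t, h⟩), Finset.card_empty, add_zero]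
      exact (Finset.card_le_card hs').trans Finset.card_le_two
  · rw [Finset.filter_eq_empty_iff.mpr (fun t _ h => h1 ⟨t, h⟩), Finset.card_empty, zero_add]
    by_cases h2 : ∃ t : H, (j t : K) + (j t : K)⁻¹ = x
    · obtain ⟨t, ht⟩ := h2
      exact (Finset.card_le_card (cheb_fib j hj x t ht)).trans Finset.card_le_two
    · rw [Finset.filter_eq_empty_iff.mpr (fun t _ h => h2 ⟨t, h⟩)]
      simp

lemma cheb_split (hF : ringChar F ≠ 2) (l : ℕ) (hl : l.Prime) :
    ∃ Bl B1 : ℤ,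
      2 * ∑ x : F, quadraticChar F ((dickson 1 (1 : F) l).eval x) = chebA F l + Bl ∧
      0 = chebA F 1 + B1 ∧
      (¬ l ∣ Fintype.card F - 1 → chebA F l = chebA F 1) ∧
      (l ∣ Fintype.card F - 1 → (l : ℤ) ∣ chebA F l) ∧
      (¬ l ∣ Fintype.card F + 1 → Bl = B1) ∧
      (l ∣ Fintype.card F + 1 → (l : ℤ) ∣ Bl) := by
  classical
  set Q := Fintype.card F with hQ
  have hQ1 : 1 < Q := Fintype.one_lt_card
  have hne : NeZero ((Q + 1 : ℕ) : F) := ⟨by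
    rw [Nat.cast_add, hQ, FiniteField.cast_card_eq_zero]; simp⟩
  let G := rootsOfUnity (Q + 1) (AlgebraicClosure F)
  have hGn : Nat.card G = Q + 1 := HasEnoughRootsOfUnity.natCard_rootsOfUnity _ _
  have hGf : Finite G := Nat.finite_of_card_ne_zero (by rw [hGn]; exact Nat.succ_ne_zero _)
  let hGF : Fintype G := Fintype.ofFinite G
  have hGcard : Fintype.card G = Q + 1 := by
    rw [← Nat.card_eq_fintype_card]
    exact hGn
  let φ := algebraMap F (AlgebraicClosure F)
  have hφ : Function.Injective φ := φ.injective
  let i : Fˣ →* (AlgebraicClosure F)ˣ := Units.map (φ : F →* AlgebraicClosure F)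
  have hi : Function.Injective i := Units.map_injective hφ
  let j : G →* (AlgebraicClosure F)ˣ := G.subtype
  have hj : Function.Injective j := Subtype.val_injective
  have hjp : ∀ t : G, j t ^ (Q + 1) = 1 := fun t => (mem_rootsOfUnity _ _).mp t.2
  have hip : ∀ t : Fˣ, i t ^ Q = i t := by
    intro t
    apply Units.ext
    change (φ t) ^ Q = φ t
    rw [← map_pow, hQ, FiniteField.pow_card]
  have hij : ∀ (s : Fˣ) (t : G), i s = j t → i s ^ 2 = 1 := by
    intro s t h
    have := hjp t
    rw [← h, pow_succ, hip] at this
    rw [sq]; exact this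
  have hc : ∀ t : G, ∃ x : F, φ x = (j t : AlgebraicClosure F) + (j t : AlgebraicClosure F)⁻¹ := by
    intro t
    apply cheb_mem_range
    have h1 : (j t : AlgebraicClosure F) ^ Q = (j t : AlgebraicClosure F)⁻¹ := by
      apply eq_inv_of_mul_eq_one_left
      rw [← pow_succ, ← Units.val_pow_eq_pow_val, hjp, Units.val_one]
    have h2 := map_add (FiniteField.frobeniusAlgHom F (AlgebraicClosure F))
      (j t : AlgebraicClosure F) (j t : AlgebraicClosure F)⁻¹
    simp only [FiniteField.frobeniusAlgHom_apply] at h2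
    rw [← hQ] at h2 ⊢
    rw [h2, inv_pow, h1, inv_inv, add_comm]
  choose c hc using hc
  -- fibre counts
  let g : Fˣ → F := fun t => (t : F) + ((t⁻¹ : Fˣ) : F)
  have hg : ∀ t, φ (g t) = (i t : AlgebraicClosure F) + (i t : AlgebraicClosure F)⁻¹ := by
    intro t
    simp [g, i]
  have hfib : ∀ x : F, (Finset.univ.filter (fun t : Fˣ => g t = x)).card +
      (Finset.univ.filter (fun t : G => c t = x)).card ≤ 2 := by
    intro x
    have := cheb_fib_two i hi j hj hij (φ x)
    simp_rw [← hg, ← hc, hφ.eq_iff] at this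
    exact this
  have hsum : ∑ x : F, ((Finset.univ.filter (fun t : Fˣ => g t = x)).card +
      (Finset.univ.filter (fun t : G => c t = x)).card) = ∑ x : F, 2 := by
    rw [Finset.sum_add_distrib]
    rw [← Finset.card_eq_sum_card_fiberwise (fun _ _ => Finset.mem_coe.mpr (Finset.mem_univ _)),
      ← Finset.card_eq_sum_card_fiberwise (fun _ _ => Finset.mem_coe.mpr (Finset.mem_univ _))]
    rw [Finset.card_univ, Finset.card_univ, hGcard, Fintype.card_units, Finset.sum_const,
      Finset.card_univ, smul_eq_mul, ← hQ]
    omega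
  have hfib2 : ∀ x : F, (Finset.univ.filter (fun t : Fˣ => g t = x)).card +
      (Finset.univ.filter (fun t : G => c t = x)).card = 2 := fun x =>
    (Finset.sum_eq_sum_iff_of_le (fun x _ => hfib x)).mp hsum x (Finset.mem_univ x)
  have hmain : ∀ f : F → ℤ, 2 * ∑ x : F, f x = ∑ t : Fˣ, f (g t) + ∑ t : G, f (c t) := by
    intro f
    rw [cheb_sum_fib g f, cheb_sum_fib c f, ← Finset.sum_add_distrib, Finset.mul_sum]
    apply Finset.sum_congr rfl
    intro x _
    rw [← add_mul]
    congr 1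
    exact_mod_cast (hfib2 x).symm
  have hg' : ∀ (d : ℕ) t, (dickson 1 (1 : F) d).eval (g t) =
      (t : F) ^ d + ((t⁻¹ : Fˣ) : F) ^ d := by
    intro d t
    exact dickson_one_one_eval_add_inv _ _ (by simp) d
  have hc' : ∀ (d : ℕ) t, (dickson 1 (1 : F) d).eval (c t) = c (t ^ d) := by
    intro d t
    apply hφ
    rw [hc, map_pow, Units.val_pow_eq_pow_val, ← inv_pow,
      ← dickson_one_one_eval_add_inv _ _ (mul_inv_cancel₀ (j t).ne_zero) d, ← hc]
    have := map_dickson (k := 1) (a := (1 : F)) φ d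
    rw [map_one] at this
    rw [← this, eval_map, eval₂_hom]
  let B : ℕ → ℤ := fun d => ∑ t : G, quadraticChar F (c (t ^ d))
  have hAB : ∀ d, 2 * ∑ x : F, quadraticChar F ((dickson 1 (1 : F) d).eval x) =
      chebA F d + B d := by
    intro d
    rw [hmain]
    simp only [hg', hc', chebA, B]
  have hgrpA := cheb_grp (fun t : Fˣ => quadraticChar F (g t)) l hl
  have hgrpB := cheb_grp (fun t : G => quadraticChar F (c t)) l hl
  rw [Fintype.card_units] at hgrpA
  rw [hGcard] at hgrpB
  have hAl : ∑ t : Fˣ, quadraticChar F (g (t ^ l)) = chebA F l := by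
    simp only [g, chebA, Units.val_pow_eq_pow_val, ← inv_pow]
  have hA1 : ∑ t : Fˣ, quadraticChar F (g t) = chebA F 1 := by
    simp only [g, chebA, pow_one]
  have hB1 : ∑ t : G, quadraticChar F (c t) = B 1 := by
    simp only [B, pow_one]
  simp only [hAl, hA1, hB1] at hgrpA hgrpB
  refine ⟨B l, B 1, hAB l, ?_, hgrpA.1, hgrpA.2, hgrpB.1, hgrpB.2⟩
  rw [← hAB 1]
  simp only [dickson_one, eval_X, quadraticChar_sum_zero hF, mul_zero]
end part3

section part4
variable {F : Type} [Field F] [Fintype F] [DecidableEq F]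

lemma cheb_ringChar (hQ8 : Fintype.card F % 8 = 1) : ringChar F ≠ 2 := by
  intro h
  have := (FiniteField.even_card_iff_char_two (F := F)).mp h
  omega

lemma cheb_dickson_neg (d : ℕ) (x : F) :
    (dickson 1 (1 : F) d).eval (-x) = (-1) ^ d * (dickson 1 (1 : F) d).eval x := by
  induction d using Nat.twoStepInduction with
  | zero => simp
  | one => simp
  | more n h1 h2 =>
    simp only [dickson_add_two, eval_sub, eval_mul, eval_X, C_1, eval_one, h1, h2]
    ring

lemma cheb_chi_neg (hQ8 : Fintype.card F % 8 = 1) (x : F) :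
    quadraticChar F (-x) = quadraticChar F x := by
  have h : quadraticChar F (-1) = 1 := by
    rw [quadraticChar_one_iff_isSquare (by simp)]
    rw [FiniteField.isSquare_neg_one_iff]
    omega
  rw [← neg_one_mul, map_mul, h, one_mul]

lemma cheb_S_even (hQ8 : Fintype.card F % 8 = 1) (d : ℕ) (hd : Odd d) :
    (2 : ℤ) ∣ ∑ x : F, quadraticChar F ((dickson 1 (1 : F) d).eval x) := by
  have hF := cheb_ringChar hQ8
  refine (ZMod.intCast_zmod_eq_zero_iff_dvd _ 2).mp ?_
  push_cast
  have hneg : ∀ x : F, (dickson 1 (1 : F) d).eval (-x) = - (dickson 1 (1 : F) d).eval x := by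
    intro x
    rw [cheb_dickson_neg, hd.neg_one_pow, neg_one_mul]
  have h2 : (2 : F) ≠ 0 := Ring.two_ne_zero hF
  refine Finset.sum_involution (fun x _ => -x) ?_ ?_ (fun _ _ => Finset.mem_univ _)
    (fun x _ => neg_neg x)
  · intro x _
    rw [hneg, cheb_chi_neg hQ8]
    exact CharTwo.add_self_eq_zero _
  · intro x _ hx hxx
    apply hx
    have hx0 : (dickson 1 (1 : F) d).eval x = 0 := by
      have := hneg x
      rw [hxx] at this
      have h3 : 2 * (dickson 1 (1 : F) d).eval x = 0 := by linear_combination this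
      exact (mul_eq_zero.mp h3).resolve_left h2
    rw [hx0]
    simp

lemma cheb_A1_mod (hQ8 : Fintype.card F % 8 = 1) : ∃ k : ℤ, chebA F 1 = 8 * k - 2 := by
  classical
  have hF := cheb_ringChar hQ8
  have h2 : (2 : F) ≠ 0 := Ring.two_ne_zero hF
  have hchi2 : quadraticChar F 2 = 1 := by
    rw [quadraticChar_one_iff_isSquare h2, FiniteField.isSquare_two_iff]
    omega
  let h : Fˣ → ℤ := fun t => quadraticChar F ((t : F) + ((t⁻¹ : Fˣ) : F))
  have hA : chebA F 1 = ∑ t, h t := by simp only [chebA, h, pow_one]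
  have htri : ∀ t, h t = 0 ∨ h t = 1 ∨ h t = -1 := fun t =>
    (quadraticChar_isQuadratic F) _
  let N := Finset.univ.filter (fun t : Fˣ => h t = -1)
  let Z := Finset.univ.filter (fun t : Fˣ => h t = 0)
  have hsum : chebA F 1 = (Fintype.card F : ℤ) - 1 - Z.card - 2 * N.card := by
    have h1 : ∀ t, h t = 1 - (if h t = 0 then 1 else 0) - 2 * (if h t = -1 then 1 else 0) := by
      intro t
      rcases htri t with h | h | h <;> rw [h] <;> norm_num
    rw [hA, Finset.sum_congr rfl (fun t _ => h1 t), Finset.sum_sub_distrib, Finset.sum_sub_distrib,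
      ← Finset.mul_sum]
    simp only [Finset.sum_boole, Finset.sum_const, Finset.card_univ, Fintype.card_units]
    have : 1 ≤ Fintype.card F := Fintype.card_pos
    simp [N, Z, Nat.cast_sub this]
  have hZ : Z.card = 2 := by
    obtain ⟨i, hi⟩ := (FiniteField.isSquare_neg_one_iff (F := F)).mpr (by omega)
    have hi0 : i ≠ 0 := by rintro rfl; simp at hi
    have hZ' : Z = {Units.mk0 i hi0, -Units.mk0 i hi0} := by
      ext t
      simp only [Z, h, Finset.mem_filter, Finset.mem_univ, true_and, quadraticChar_eq_zero_iff,
        Finset.mem_insert, Finset.mem_singleton, Units.ext_iff, Units.val_neg, Units.val_mk0,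
        Units.val_inv_eq_inv_val]
      have ht : (t : F) ≠ 0 := t.ne_zero
      constructor
      · intro h1
        have h3 : ((t : F) - i) * (t + i) = 0 := by
          field_simp at h1
          linear_combination h1 + hi
        rcases mul_eq_zero.mp h3 with h4 | h4
        · left; exact sub_eq_zero.mp h4
        · right; exact eq_neg_of_add_eq_zero_left h4
      · intro h1
        field_simp
        rcases h1 with h1 | h1 <;> rw [h1] <;> linear_combination -hi
    rw [hZ', Finset.card_pair]
    intro h3
    have h4 := congrArg Units.val h3
    simp only [Units.val_neg, Units.val_mk0] at h4
    have h5 : 2 * i = 0 := by linear_combination h4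
    exact hi0 ((mul_eq_zero.mp h5).resolve_left h2)
  have hN : 4 ∣ N.card := by
    rw [Finset.card_eq_sum_card_fiberwise (f := fun t : Fˣ => ((t : F) + ((t⁻¹ : Fˣ) : F)) ^ 2)
      (t := Finset.univ) (fun _ _ => Finset.mem_coe.mpr (Finset.mem_univ _))]
    apply Finset.dvd_sum
    intro x _
    by_cases hex : ∃ t : Fˣ, h t = -1 ∧ ((t : F) + ((t⁻¹ : Fˣ) : F)) ^ 2 = x
    · obtain ⟨t, ht, htx⟩ := hex
      have hinv : ∀ s : Fˣ, h s⁻¹ = h s := by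
        intro s; simp only [h, inv_inv]; rw [add_comm]
      have hneg : ∀ s : Fˣ, h (-s) = h s := by
        intro s
        simp only [h, inv_neg, Units.val_neg]
        rw [← neg_add, cheb_chi_neg hQ8]
      have hn1 : t ≠ t⁻¹ := by
        intro e
        have e2 : (t : F) ^ 2 = 1 := by
          have : t * t = 1 := by nth_rw 1 [e]; simp
          rw [sq, ← Units.val_mul, this, Units.val_one]
        have e3 : h t = 1 := by
          rcases (sq_eq_sq_iff_eq_or_eq_neg.mp (e2.trans (one_pow 2).symm)) with e4 | e4
          · simp only [h, ← e, e4]; norm_num [hchi2]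
          · simp only [h, ← e, e4]
            rw [← neg_add, cheb_chi_neg hQ8]; norm_num [hchi2]
        rw [e3] at ht; norm_num at ht
      have hn2 : t ≠ -t⁻¹ := by
        intro e
        have e2 : h t = 0 := by
          simp only [h]
          nth_rw 1 [e]
          simp
        rw [e2] at ht; norm_num at ht
      have hn3 : ∀ s : Fˣ, s ≠ -s := by
        intro s e
        have h4 := congrArg Units.val e
        simp only [Units.val_neg] at h4
        have h5 : 2 * (s : F) = 0 := by linear_combination h4
        exact s.ne_zero ((mul_eq_zero.mp h5).resolve_left h2)
      have hset : N.filter (fun s : Fˣ => ((s : F) + ((s⁻¹ : Fˣ) : F)) ^ 2 = x) =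
          {t, t⁻¹, -t, -t⁻¹} := by
        ext s
        simp only [N, Finset.mem_filter, Finset.mem_univ, true_and, Finset.mem_insert,
          Finset.mem_singleton]
        constructor
        · rintro ⟨-, hs⟩
          rw [← htx] at hs
          simp only [Units.val_inv_eq_inv_val] at hs
          rcases sq_eq_sq_iff_eq_or_eq_neg.mp hs with h3 | h3
          · rcases cheb_add_inv_eq s.ne_zero t.ne_zero h3 with h4 | h4
            · left; exact Units.ext h4
            · right; left; exact Units.ext (by rw [h4, Units.val_inv_eq_inv_val])
          · have h3' : (s : F) + (s : F)⁻¹ = ((-t : Fˣ) : F) + ((-t : Fˣ) : F)⁻¹ := by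
              rw [h3, Units.val_neg, inv_neg]; ring
            rcases cheb_add_inv_eq s.ne_zero (-t).ne_zero h3' with h4 | h4
            · right; right; left; exact Units.ext h4
            · right; right; right
              exact Units.ext (by rw [h4, ← inv_neg, Units.val_inv_eq_inv_val])
        · rintro (rfl | rfl | rfl | rfl)
          · exact ⟨ht, htx⟩
          · refine ⟨by rw [hinv]; exact ht, ?_⟩
            rw [← htx, inv_inv, add_comm]
          · refine ⟨by rw [hneg]; exact ht, ?_⟩
            rw [← htx, inv_neg, Units.val_neg, Units.val_neg]; ring
          · refine ⟨by rw [hneg, hinv]; exact ht, ?_⟩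
            rw [← htx, inv_neg, inv_inv, Units.val_neg, Units.val_neg]; ring
      rw [hset]
      have h6 : t⁻¹ ≠ -t := fun e => hn2 (by rw [e, neg_neg])
      have h7 : -t ≠ -t⁻¹ := fun e => hn1 (neg_injective e)
      rw [Finset.card_insert_of_notMem, Finset.card_insert_of_notMem, Finset.card_pair h7]
      · simp only [Finset.mem_insert, Finset.mem_singleton, not_or]
        exact ⟨h6, hn3 _⟩
      · simp only [Finset.mem_insert, Finset.mem_singleton, not_or]
        exact ⟨hn1, hn3 _, hn2⟩
    · rw [Finset.filter_eq_empty_iff.mpr]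
      · simp
      · intro t htN htx
        exact hex ⟨t, (Finset.mem_filter.mp htN).2, htx⟩
  obtain ⟨m, hm⟩ := hN
  rw [hsum, hZ, hm]
  refine ⟨(Fintype.card F : ℤ) / 8 - m, ?_⟩
  push_cast
  omega
end part4

section part5
variable {F : Type} [Field F] [Fintype F] [DecidableEq F]

/-- The quadratic character with values in `R`. -/
noncomputable def chebChi (F : Type) [Field F] [Fintype F] [DecidableEq F]
    (R : Type*) [CommRing R] : MulChar F R :=
  (quadraticChar F).ringHomComp (Int.castRingHom R)

lemma chebChi_apply {R : Type*} [CommRing R] (x : F) :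
    chebChi F R x = ((quadraticChar F x : ℤ) : R) := rfl

lemma cheb_orderOf_gen {R : Type*} [CommRing R] (κ : MulChar F R)
    {g : Fˣ} (hg : ∀ x, x ∈ Subgroup.zpowers g) (k : ℕ) :
    κ (g : F) ^ k = 1 ↔ orderOf κ ∣ k := by
  rw [orderOf_dvd_iff_pow_eq_one, MulChar.eq_iff hg, MulChar.pow_apply_coe,
    MulChar.one_apply_coe]

/-- A character of even order `2 * n` satisfies `κ ^ n = χ`. -/
lemma cheb_pow_half {R : Type*} [CommRing R] [IsDomain R] (hF : ringChar F ≠ 2)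
    (κ : MulChar F R) (n : ℕ) (hn : n ≠ 0)
    (hκ : orderOf κ = 2 * n) : κ ^ n = chebChi F R := by
  obtain ⟨g, hg⟩ := IsCyclic.exists_generator (α := Fˣ)
  rw [MulChar.eq_iff hg, MulChar.pow_apply_coe]
  have h1 : (κ (g : F) ^ n) ^ 2 = 1 := by
    rw [← pow_mul, cheb_orderOf_gen κ hg, hκ, mul_comm]
  have h2 : κ (g : F) ^ n ≠ 1 := by
    rw [Ne, cheb_orderOf_gen κ hg, hκ]
    intro h
    have := Nat.le_of_dvd (Nat.pos_of_ne_zero hn) h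
    omega
  have h3 : κ (g : F) ^ n = -1 := by
    rcases sq_eq_sq_iff_eq_or_eq_neg.mp (h1.trans (one_pow 2).symm) with h | h
    · exact absurd h h2
    · exact h
  rw [h3, chebChi_apply]
  have h4 : quadraticChar F (g : F) = -1 := by
    rcases quadraticChar_dichotomy g.ne_zero with h | h
    · exfalso
      apply quadraticChar_ne_one hF
      rw [MulChar.eq_iff hg, h, MulChar.one_apply_coe]
    · exact h
  rw [h4]; simp

lemma cheb_sum_pow {R : Type*} [CommRing R] [IsDomain R] (ξ : MulChar F R) (n : ℕ)
    (hξ : orderOf ξ = n) (hn : n ≠ 0) (f : F → R) :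
    ∑ t : Fˣ, f ((t : F) ^ n) = ∑ i ∈ Finset.range n, ∑ w : Fˣ, ξ (w : F) ^ i * f w := by
  classical
  obtain ⟨g, hg⟩ := IsCyclic.exists_generator (α := Fˣ)
  have hnQ : n ∣ Fintype.card Fˣ := by
    rw [← hξ, Fintype.card_units]; exact MulChar.orderOf_dvd_card_sub_one F ξ
  have hgeom : ∀ w : Fˣ, ((Finset.univ.filter (fun t : Fˣ => t ^ n = w)).card : R) =
      ∑ i ∈ Finset.range n, ξ (w : F) ^ i := by
    intro w
    by_cases hw : ∃ s : Fˣ, s ^ n = w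
    · have h1 : (Finset.univ.filter (fun t : Fˣ => t ^ n = w)).card = n := by
        have := MonoidHom.card_fiber_eq_of_mem_range (powMonoidHom n : Fˣ →* Fˣ) (x := w) (y := 1)
          (by simpa using hw) ⟨1, by simp⟩
        have h2 := IsCyclic.card_powMonoidHom_ker (G := Fˣ) n
        rw [Nat.card_eq_fintype_card, Nat.card_eq_fintype_card,
          Nat.gcd_eq_right hnQ, Fintype.card_subtype] at h2
        simp only [MonoidHom.mem_ker] at h2
        rw [h2] at this
        simpa using this
      obtain ⟨s, rfl⟩ := hw
      have h3 : ξ ((s ^ n : Fˣ) : F) = 1 := by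
        rw [Units.val_pow_eq_pow_val, map_pow, ← MulChar.pow_apply_coe, ← hξ, pow_orderOf_eq_one,
          MulChar.one_apply_coe]
      rw [h1, h3]; simp
    · rw [Finset.filter_eq_empty_iff.mpr (fun t _ h => hw ⟨t, h⟩), Finset.card_empty, Nat.cast_zero]
      have h1 : ξ (w : F) ≠ 1 := by
        intro h
        obtain ⟨k, rfl⟩ := (mem_powers_iff_mem_zpowers).mpr (hg w)
        simp only [Units.val_pow_eq_pow_val, map_pow] at h
        rw [cheb_orderOf_gen ξ hg, hξ] at h
        obtain ⟨j, rfl⟩ := h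
        exact hw ⟨g ^ j, by simp only [← pow_mul, mul_comm]⟩
      have h2 := mul_geom_sum (ξ (w : F)) n
      have h3 : ξ (w : F) ^ n = 1 := by
        rw [← MulChar.pow_apply_coe, ← hξ, pow_orderOf_eq_one, MulChar.one_apply_coe]
      rw [h3, sub_self] at h2
      exact ((mul_eq_zero.mp h2).resolve_left (sub_ne_zero.mpr h1)).symm
  rw [Finset.sum_comm]
  simp_rw [← Finset.sum_mul, ← hgeom, Finset.card_filter]
  push_cast
  simp_rw [Finset.sum_mul]
  rw [Finset.sum_comm]
  apply Finset.sum_congr rfl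
  intro t _
  simp

lemma cheb_sum_jacobi {R : Type*} [CommRing R] (ψ φ : MulChar F R) :
    ∑ w : Fˣ, ψ (w : F) * φ (1 + (w : F)) = ψ (-1) * jacobiSum ψ φ := by
  classical
  have h1 : ∑ w : Fˣ, ψ (w : F) * φ (1 + (w : F)) = ∑ x : F, ψ x * φ (1 + x) := by
    refine Finset.sum_of_injOn (fun w : Fˣ => (w : F)) (fun a _ b _ h => Units.ext h)
      (fun _ _ => Finset.mem_coe.mpr (Finset.mem_univ _)) ?_ (fun _ _ => rfl)
    intro x _ hx
    have hx0 : x = 0 := by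
      by_contra h0
      exact hx ⟨Units.mk0 x h0, by simp, rfl⟩
    rw [hx0, MulChar.map_zero, zero_mul]
  rw [h1, jacobiSum, Finset.mul_sum, ← Equiv.sum_comp (Equiv.neg F)]
  apply Finset.sum_congr rfl
  intro x _
  simp only [Equiv.neg_apply]
  rw [← neg_one_mul x, map_mul]
  ring_nf

lemma cheb_A_jacobi {R : Type*} [CommRing R] [IsDomain R] (hF : ringChar F ≠ 2)
    (κ : MulChar F R) (m : ℕ) (hm : Odd m) (hκ : orderOf κ = 4 * m) :
    ((chebA F m : ℤ) : R) = ∑ i ∈ Finset.range (2 * m),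
      (κ ^ (2 * i + 1)) (-1) * jacobiSum (κ ^ (2 * i + 1)) (chebChi F R) := by
  have hm0 : m ≠ 0 := hm.pos.ne'
  have hhalf := cheb_pow_half hF κ (2 * m) (by omega) (by rw [hκ]; ring)
  have hξ : orderOf (κ ^ 2) = 2 * m := by
    rw [orderOf_pow' _ two_ne_zero, hκ, Nat.gcd_eq_right ⟨2 * m, by ring⟩]
    omega
  have h1 := cheb_sum_pow (κ ^ 2) (2 * m) hξ (by omega) (fun w => κ w * chebChi F R (1 + w))
  rw [chebA_eq m hm]
  push_cast
  have h2 : ∀ t : Fˣ, ((quadraticChar F (t : F) : ℤ) : R) *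
      ((quadraticChar F (1 + (t : F) ^ (2 * m)) : ℤ) : R) =
      κ ((t : F) ^ (2 * m)) * chebChi F R (1 + (t : F) ^ (2 * m)) := by
    intro t
    rw [← chebChi_apply, ← chebChi_apply, map_pow, ← MulChar.pow_apply_coe, hhalf]
  simp_rw [h2]
  rw [h1]
  apply Finset.sum_congr rfl
  intro i _
  rw [← cheb_sum_jacobi]
  apply Finset.sum_congr rfl
  intro w _
  rw [← mul_assoc, MulChar.pow_apply_coe, MulChar.pow_apply_coe]
  congr 1
  ring

end part5

section part6
variable {F : Type} [Field F] [Fintype F] [DecidableEq F]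

lemma cheb_ringChar_C : ringChar ℂ ≠ ringChar F := by
  intro h
  have h1 : ringChar ℂ = 0 := ringChar.eq_zero
  rw [h1] at h
  have := CharP.ringChar_ne_zero_of_finite F
  exact this h.symm

lemma cheb_jacobi_norm_sq (ψ : MulChar F ℂ) (hF : ringChar F ≠ 2) (h1 : ψ ≠ 1)
    (h2 : ψ * chebChi F ℂ ≠ 1) :
    jacobiSum ψ (chebChi F ℂ) * (starRingEnd ℂ) (jacobiSum ψ (chebChi F ℂ)) = Fintype.card F := by
  have hχ : chebChi F ℂ ≠ 1 := by
    intro h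
    apply quadraticChar_ne_one hF
    ext t
    have := congrArg (fun c : MulChar F ℂ => c (t : F)) h
    simp only [chebChi_apply, MulChar.one_apply_coe] at this
    rw [MulChar.one_apply_coe]
    exact_mod_cast this
  rw [← jacobiSum_mul_jacobiSum_inv cheb_ringChar_C h1 hχ h2, ← jacobiSum_ringHomComp]
  congr 2
  · rw [← MulChar.star_eq_inv]; rfl
  · rw [← MulChar.star_eq_inv]; rfl

lemma cheb_T_norm (ψ : MulChar F ℂ) (hF : ringChar F ≠ 2) (h1 : ψ ≠ 1)
    (h2 : ψ * chebChi F ℂ ≠ 1) (q : ℕ) (hq : Fintype.card F = q ^ 2) :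
    ‖ψ (-1) * jacobiSum ψ (chebChi F ℂ)‖ = q := by
  have h3 := cheb_jacobi_norm_sq ψ hF h1 h2
  rw [Complex.mul_conj, hq] at h3
  have h4 : Complex.normSq (jacobiSum ψ (chebChi F ℂ)) = (q : ℝ) ^ 2 := by exact_mod_cast h3
  rw [Complex.normSq_eq_norm_sq] at h4
  have h5 : ‖jacobiSum ψ (chebChi F ℂ)‖ = q := by
    exact (pow_left_inj₀ (norm_nonneg _) (Nat.cast_nonneg _) two_ne_zero).mp h4
  have h6 : ‖ψ (-1)‖ = 1 := by
    have : ψ (-1) ^ 2 = 1 := by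
      rw [← map_pow]; simp
    have h7 : ‖ψ (-1)‖ ^ 2 = 1 := by rw [← norm_pow, this, norm_one]
    exact (pow_left_inj₀ (norm_nonneg _) zero_le_one two_ne_zero).mp (h7.trans (one_pow 2).symm)
  rw [norm_mul, h5, h6, one_mul]

lemma cheb_bound (hF : ringChar F ≠ 2) (l q : ℕ) (hl : Odd l) (hq : Fintype.card F = q ^ 2)
    (hdvd : 4 * l ∣ Fintype.card F - 1) :
    |chebA F l - chebA F 1| ≤ (2 * (l : ℤ) - 2) * q := by
  have hl0 : 0 < l := hl.pos
  obtain ⟨κ, hκ⟩ := MulChar.exists_mulChar_orderOf F hdvd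
    (Complex.isPrimitiveRoot_exp (4 * l) (by omega))
  have hκl : orderOf (κ ^ l) = 4 * 1 := by
    rw [orderOf_pow' _ hl0.ne', hκ, Nat.gcd_eq_right ⟨4, by ring⟩]
    rw [Nat.mul_div_cancel _ hl0]
  let T : ℕ → ℂ := fun i => (κ ^ (2 * i + 1)) (-1) * jacobiSum (κ ^ (2 * i + 1)) (chebChi F ℂ)
  have hAl : ((chebA F l : ℤ) : ℂ) = ∑ i ∈ Finset.range (2 * l), T i :=
    cheb_A_jacobi hF κ l hl hκ
  obtain ⟨m, hm⟩ := hl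
  have hA1 : ((chebA F 1 : ℤ) : ℂ) = T m + T (3 * m + 1) := by
    rw [cheb_A_jacobi hF (κ ^ l) 1 odd_one hκl]
    rw [Finset.sum_range_succ, Finset.sum_range_succ, Finset.sum_range_zero, zero_add]
    simp only [T, ← pow_mul]
    congr 4 <;> subst hm <;> ring
  have hsub : ({m, 3 * m + 1} : Finset ℕ) ⊆ Finset.range (2 * l) := by
    intro x hx
    simp only [Finset.mem_insert, Finset.mem_singleton] at hx
    rw [Finset.mem_range]
    omega
  have hpair : ∑ i ∈ ({m, 3 * m + 1} : Finset ℕ), T i = T m + T (3 * m + 1) :=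
    Finset.sum_pair (by omega)
  have hdiff : ((chebA F l - chebA F 1 : ℤ) : ℂ) =
      ∑ i ∈ Finset.range (2 * l) \ {m, 3 * m + 1}, T i := by
    rw [Int.cast_sub, hAl, hA1, ← hpair, ← Finset.sum_sdiff hsub]
    ring
  have hhalf := cheb_pow_half hF κ (2 * l) (by omega) (by rw [hκ]; ring)
  have hT : ∀ i, ‖T i‖ = q := by
    intro i
    apply cheb_T_norm _ hF _ _ _ hq
    · rw [Ne, ← orderOf_dvd_iff_pow_eq_one, hκ]
      intro h
      have : 2 ∣ 2 * i + 1 := Dvd.dvd.trans ⟨2 * l, by ring⟩ h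
      omega
    · rw [← hhalf, ← pow_add, Ne, ← orderOf_dvd_iff_pow_eq_one, hκ]
      intro h
      have : 2 ∣ 2 * i + 1 + 2 * l := Dvd.dvd.trans ⟨2 * l, by ring⟩ h
      omega
  have hcard : (Finset.range (2 * l) \ {m, 3 * m + 1}).card = 2 * l - 2 := by
    rw [Finset.card_sdiff_of_subset hsub, Finset.card_range, Finset.card_pair (by omega)]
  have hnorm : ‖((chebA F l - chebA F 1 : ℤ) : ℂ)‖ ≤ (2 * l - 2 : ℕ) * (q : ℝ) := by
    rw [hdiff]
    refine (norm_sum_le _ _).trans ?_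
    simp only [hT, Finset.sum_const, hcard, nsmul_eq_mul, le_refl]
  rw [Complex.norm_intCast] at hnorm
  have h9 : ((2 * l - 2 : ℕ) : ℤ) = 2 * (l : ℤ) - 2 := by omega
  rw [← h9]
  exact_mod_cast hnorm
end part6

section part7

lemma cheb_gauss_alg (J : GaussianInt) (p a : ℕ) (hp : p.Prime) (hp4 : p % 4 = 1)
    (ha : 1 ≤ a)
    (hJ : J.norm = (p : ℤ) ^ (2 * a)) (hpJ : ¬ (p : ℤ) ∣ 2 * J.re) (hre : J.re % 4 = 3) :
    ∃ w : GaussianInt, w.norm = p ∧ J = -w ^ (2 * a) := by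
  have hJJ : J * star J = ((p : ℤ) : GaussianInt) ^ (2 * a) := by
    rw [← Zsqrtd.norm_eq_mul_conj, hJ]; push_cast; rfl
  have hsum : J + star J = ((2 * J.re : ℤ) : GaussianInt) := by
    ext
    · simp; ring
    · simp
  have hcop : IsCoprime J (star J) := by
    have h1 : IsCoprime (2 * J.re) ((p : ℤ) ^ (2 * a)) := by
      apply IsCoprime.pow_right
      exact ((Prime.coprime_iff_not_dvd (Nat.prime_iff_prime_int.mp hp)).mpr hpJ).symm
    have h2 := h1.map (Int.castRingHom GaussianInt)
    simp only [eq_intCast, Int.cast_pow] at h2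
    rw [← hsum, ← hJJ] at h2
    obtain ⟨s, t, hst⟩ := h2
    exact ⟨s + t * star J, s, by linear_combination hst⟩
  obtain ⟨v, u, hu⟩ := exists_associated_pow_of_mul_eq_pow' hcop hJJ
  have hnn : ∀ z : GaussianInt, 0 ≤ z.norm := fun z => Zsqrtd.norm_nonneg (by norm_num) z
  have hun : (u : GaussianInt).norm = 1 :=
    (Zsqrtd.norm_eq_one_iff' (by norm_num) _).mpr u.isUnit
  have hnpow : ∀ (z : GaussianInt) (n : ℕ), (z ^ n).norm = z.norm ^ n :=
    fun z n => map_pow (Zsqrtd.normMonoidHom (d := -1)) z n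
  have hvn : v.norm = p := by
    have h1 := congrArg Zsqrtd.norm hu
    rw [Zsqrtd.norm_mul, hun, mul_one, hnpow, hJ] at h1
    exact (pow_left_inj₀ (hnn v) (by positivity) (by omega)).mp h1
  -- normalise
  have hw : ∃ (w e : GaussianInt), w.norm = p ∧ e.norm = 1 ∧ J = e * w ^ (2 * a) ∧
      w.re % 2 = 1 ∧ w.im % 2 = 0 := by
    have h1 : v.re * v.re + v.im * v.im = p := by
      rw [← hvn, Zsqrtd.norm_def]; ring
    rcases Int.even_or_odd' v.re with ⟨r, hr | hr⟩ <;> rcases Int.even_or_odd' v.im with ⟨s, hs | hs⟩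
    · exfalso
      rw [hr, hs] at h1
      have : 2 * (2 * (r * r + s * s)) = (p : ℤ) := by rw [← h1]; ring
      omega
    · refine ⟨v * ⟨0, 1⟩, u * (-1) ^ a, ?_, ?_, ?_, ?_, ?_⟩
      · rw [Zsqrtd.norm_mul, hvn]; simp [Zsqrtd.norm_def]
      · rw [Zsqrtd.norm_mul, hun, hnpow]; simp [Zsqrtd.norm_def]
      · have h2 : ((⟨0, 1⟩ : GaussianInt)) ^ 2 = -1 := by
          ext <;> simp [sq]
        rw [← hu, mul_pow, pow_mul (⟨0, 1⟩ : GaussianInt), h2]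
        have h3 : ((-1 : GaussianInt) ^ a) * (-1) ^ a = 1 := by
          rw [← mul_pow]; simp
        linear_combination (-(v ^ (2 * a) * u)) * h3
      · simp; omega
      · simp; omega
    · refine ⟨v, u, hvn, hun, ?_, by omega, by omega⟩
      rw [← hu, mul_comm]
    · exfalso
      rw [hr, hs] at h1
      have : 2 * (2 * (r * r + s * s + r + s) + 1) = (p : ℤ) := by rw [← h1]; ring
      omega
  obtain ⟨w, e, hwn, hen, hJe, hwr, hwi⟩ := hw
  refine ⟨w, hwn, ?_⟩
  have h4 : (4 : GaussianInt) ∣ w ^ (2 * a) - 1 := by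
    have h5 : (4 : GaussianInt) ∣ w ^ 2 - 1 := by
      obtain ⟨r, hr⟩ : ∃ r, w.re = 2 * r + 1 := ⟨w.re / 2, by omega⟩
      obtain ⟨s, hs⟩ : ∃ s, w.im = 2 * s := ⟨w.im / 2, by omega⟩
      refine ⟨⟨r * r + r - s * s, (2 * r + 1) * s⟩, ?_⟩
      have h44 : (4 : GaussianInt) = ((4 : ℤ) : GaussianInt) := by norm_num
      rw [h44]
      ext
      · simp [sq, hr, hs]; ring
      · simp [sq, hr, hs]; ring
    refine h5.trans ?_
    rw [pow_mul]
    have := sub_dvd_pow_sub_pow (w ^ 2) 1 a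
    rwa [one_pow] at this
  obtain ⟨z, hz⟩ := h4
  have hwz : w ^ (2 * a) = 1 + ((4 : ℤ) : GaussianInt) * z := by
    rw [show ((4 : ℤ) : GaussianInt) = 4 by norm_num]; linear_combination hz
  have hzr : (w ^ (2 * a)).re = 1 + 4 * z.re := by
    rw [hwz]; simp
  have hzi : (w ^ (2 * a)).im = 4 * z.im := by
    rw [hwz]; simp
  have hee : e.re * e.re + e.im * e.im = 1 := by
    have := hen
    rw [Zsqrtd.norm_def] at this
    linarith
  have hJre : J.re = e.re * (1 + 4 * z.re) - e.im * (4 * z.im) := by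
    rw [hJe, Zsqrtd.re_mul, hzr, hzi]; ring
  have b1 : e.re ≤ 1 := by nlinarith
  have b2 : -1 ≤ e.re := by nlinarith
  have hem : e = -1 := by
    have : e.re = -1 := by
      have h8 : e.re = -1 ∨ e.re = 0 ∨ e.re = 1 := by omega
      rcases h8 with h | h | h
      · exact h
      · exfalso
        rw [h] at hJre
        have : J.re = 4 * (-(e.im * z.im)) := by rw [hJre]; ring
        omega
      · exfalso
        rw [h] at hJre
        have : J.re = 1 + 4 * (z.re - e.im * z.im) := by rw [hJre]; ring
        omega
    have h9 : e.im = 0 := by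
      rw [this] at hee
      have : e.im * e.im = 0 := by linarith
      exact mul_self_eq_zero.mp this
    ext
    · simpa using this
    · simpa using h9
  rw [hJe, hem, neg_one_mul]

variable {F : Type} [Field F] [Fintype F] [DecidableEq F]

lemma cheb_gauss_J (hQ8 : Fintype.card F % 8 = 1) :
    ∃ J : GaussianInt, J.norm = Fintype.card F ∧ chebA F 1 = 2 * J.re := by
  have hF := cheb_ringChar hQ8
  have hQ1 : 1 < Fintype.card F := Fintype.one_lt_card
  have hprim : IsPrimitiveRoot (⟨0, 1⟩ : GaussianInt) 4 := by
    have h2 : ((⟨0, 1⟩ : GaussianInt)) ^ 2 = -1 := by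
      ext <;> simp [sq]
    have := IsPrimitiveRoot.mk_of_lt (⟨0, 1⟩ : GaussianInt) (k := 4) (by norm_num)
      (by rw [show 4 = 2 * 2 by norm_num, pow_mul, h2]; norm_num)
    apply this
    intro k hk hk4 h
    interval_cases k
    · have := congrArg Zsqrtd.re h
      simp at this
    · rw [h2] at h
      have := congrArg Zsqrtd.re h
      norm_num at this
    · rw [pow_succ, h2] at h
      have := congrArg Zsqrtd.re h
      norm_num at this
  obtain ⟨θ, hθ⟩ := MulChar.exists_mulChar_orderOf F (n := 4) (by omega) hprim
  have hneg : θ (-1) = 1 := by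
    obtain ⟨g, hg⟩ := IsCyclic.exists_generator (α := Fˣ)
    obtain ⟨k, hk⟩ := (mem_powers_iff_mem_zpowers).mpr (hg (-1))
    simp only at hk
    have h1 : g ^ (2 * k) = 1 := by
      rw [mul_comm, pow_mul, hk]; simp
    have h2 : Fintype.card F - 1 ∣ 2 * k := by
      rw [← Fintype.card_units, ← Nat.card_eq_fintype_card,
        ← orderOf_eq_card_of_forall_mem_zpowers hg]
      exact orderOf_dvd_of_pow_eq_one h1
    have h3 : 8 ∣ Fintype.card F - 1 := by omega
    have h4 : 8 ∣ 2 * k := h3.trans h2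
    have h5 : 4 ∣ k := by omega
    rw [← hθ, ← cheb_orderOf_gen θ hg, ← map_pow, ← Units.val_pow_eq_pow_val, hk] at h5
    simpa using h5
  let χ := chebChi F GaussianInt
  let J := jacobiSum θ χ
  have hstar : star J = jacobiSum (θ ^ 3) χ := by
    have h1 := jacobiSum_ringHomComp θ χ (starRingEnd GaussianInt)
    rw [starRingEnd_apply] at h1
    rw [← h1]
    congr 1
    · apply MulChar.ext
      intro t
      rw [MulChar.ringHomComp_apply, MulChar.pow_apply_coe, starRingEnd_apply]
      have h2 : θ (t : F) ^ 4 = 1 := by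
        rw [← MulChar.pow_apply_coe, ← hθ, pow_orderOf_eq_one, MulChar.one_apply_coe]
      have h3 : IsUnit (θ (t : F)) := IsUnit.of_pow_eq_one h2 (by norm_num)
      have h4 : (θ (t : F)).norm = 1 := (Zsqrtd.norm_eq_one_iff' (by norm_num) _).mpr h3
      have h5 := Zsqrtd.norm_eq_mul_conj (θ (t : F))
      rw [h4] at h5
      push_cast at h5
      calc star (θ (t : F)) = θ (t : F) ^ 4 * star (θ (t : F)) := by rw [h2, one_mul]
        _ = θ (t : F) ^ 3 * (θ (t : F) * star (θ (t : F))) := by ring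
        _ = θ (t : F) ^ 3 := by rw [← h5, mul_one]
  have hhalf : θ ^ 2 = χ := cheb_pow_half hF θ 2 (by norm_num) hθ
  refine ⟨J, ?_, ?_⟩
  · have hinj : ∀ ψ : MulChar F GaussianInt, ψ.ringHomComp GaussianInt.toComplex = 1 → ψ = 1 := by
      intro ψ h
      apply MulChar.ext
      intro t
      have := congrArg (fun c : MulChar F ℂ => c (t : F)) h
      simp only [MulChar.ringHomComp_apply, MulChar.one_apply_coe] at this
      rw [MulChar.one_apply_coe]
      apply GaussianInt.toComplex_injective
      rw [this, map_one]
    have hχC : χ.ringHomComp GaussianInt.toComplex = chebChi F ℂ := by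
      ext t
      rw [MulChar.ringHomComp_apply, chebChi_apply, chebChi_apply, map_intCast]
    have h1 := cheb_jacobi_norm_sq (θ.ringHomComp GaussianInt.toComplex) hF (by
        intro h
        have := hinj _ h
        rw [← orderOf_eq_one_iff, hθ] at this
        norm_num at this) (by
        intro h
        rw [← hχC, ← MulChar.ringHomComp_mul, ← hhalf, ← pow_succ'] at h
        have := hinj _ h
        rw [← orderOf_dvd_iff_pow_eq_one, hθ] at this
        norm_num at this)
    rw [← hχC, jacobiSum_ringHomComp, ← GaussianInt.toComplex_star, ← map_mul,
      ← Zsqrtd.norm_eq_mul_conj, map_intCast] at h1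
    exact_mod_cast h1
  · have h1 := cheb_A_jacobi hF θ 1 odd_one hθ
    rw [Finset.sum_range_succ, Finset.sum_range_succ, Finset.sum_range_zero, zero_add] at h1
    simp only [mul_zero, zero_add, pow_one, mul_one] at h1
    norm_num at h1
    have h3 : (θ ^ 3) (-1) = 1 := by
      rw [MulChar.pow_apply' _ (by norm_num), hneg, one_pow]
    rw [hneg, h3, one_mul, one_mul] at h1
    change _ = J + jacobiSum (θ ^ 3) χ at h1
    rw [← hstar] at h1
    have h4 := congrArg Zsqrtd.re h1
    simp at h4
    rw [h4]; ring

lemma cheb_pow_card8 (p a : ℕ) (hp4 : p % 4 = 1) : p ^ (2 * a) % 8 = 1 := by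
  have h : p ^ 2 % 8 = 1 := by
    have h8 : p % 8 = 1 ∨ p % 8 = 5 := by omega
    rcases h8 with h | h <;> simp [Nat.pow_mod, h]
  rw [pow_mul, Nat.pow_mod, h, one_pow]
  norm_num


lemma cheb_A1_mod_l (l p a : ℕ) (hl : l.Prime) (hl4 : l % 4 = 1) (hp : p.Prime) (hp4 : p % 4 = 1)
    (hne : p ≠ l) (ha : 1 ≤ a) (hcard : Fintype.card F = p ^ (2 * a)) :
    (((p : ZMod l) ^ (2 * a) = -1 → l - 1 ∣ 4 * a → ((chebA F 1 : ℤ) : ZMod l) = 0)) ∧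
    (l - 1 ∣ 2 * a → ((chebA F 1 : ℤ) : ZMod l) = -2) := by
  have : Fact l.Prime := ⟨hl⟩
  have hQ8 : Fintype.card F % 8 = 1 := by rw [hcard]; exact cheb_pow_card8 p a hp4
  obtain ⟨J, hJn, hJA⟩ := cheb_gauss_J hQ8
  obtain ⟨k, hk⟩ := cheb_A1_mod hQ8
  have hnd := chebA_one_not_dvd (F := F) p (2 * a) hp hp4 (by omega) hcard
  obtain ⟨w, hwn, hJw⟩ := cheb_gauss_alg J p a hp hp4 ha
    (by rw [hJn, hcard]; push_cast; rfl) (by rwa [← hJA]) (by omega)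
  obtain ⟨r, hr⟩ := (ZMod.exists_sq_eq_neg_one_iff (p := l)).mpr (by omega)
  let f : GaussianInt →+* ZMod l := Zsqrtd.lift ⟨r, by rw [← hr]; push_cast; rfl⟩
  have hA : ((chebA F 1 : ℤ) : GaussianInt) = -(w ^ (2 * a) + (star w) ^ (2 * a)) := by
    have h1 : ((chebA F 1 : ℤ) : GaussianInt) = J + star J := by
      rw [hJA]
      ext
      · simp; ring
      · simp
    rw [h1, hJw, star_neg, star_pow]; ring
  have hfA := congrArg f hA
  rw [map_intCast, map_neg, map_add, map_pow, map_pow] at hfA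
  have hxy : f w * f (star w) = (p : ZMod l) := by
    rw [← map_mul, ← Zsqrtd.norm_eq_mul_conj, hwn, map_intCast]; simp
  have hp0 : (p : ZMod l) ≠ 0 := by
    rw [Ne, ZMod.natCast_eq_zero_iff]
    intro h
    exact hne ((Nat.prime_dvd_prime_iff_eq hl hp).mp h).symm
  have hx0 : f w ≠ 0 := left_ne_zero_of_mul (hxy ▸ hp0)
  have hy0 : f (star w) ≠ 0 := right_ne_zero_of_mul (hxy ▸ hp0)
  have hpow : ∀ (x : ZMod l) (n : ℕ), x ≠ 0 → l - 1 ∣ n → x ^ n = 1 := by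
    rintro x n hx ⟨m, rfl⟩
    rw [pow_mul, ZMod.pow_card_sub_one_eq_one hx, one_pow]
  constructor
  · intro h1 h2
    rw [← hxy, mul_pow] at h1
    have hx4 := hpow _ _ hx0 h2
    have hx2 : (f w ^ (2 * a)) ^ 2 = 1 := by rw [← pow_mul, ← hx4]; congr 1; ring
    rw [hfA]
    rcases sq_eq_sq_iff_eq_or_eq_neg.mp (hx2.trans (one_pow 2).symm) with h | h
    · rw [h, one_mul] at h1; rw [h, h1]; ring
    · rw [h] at h1 ⊢
      have : f (star w) ^ (2 * a) = 1 := by linear_combination -h1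
      rw [this]; ring
  · intro h2
    rw [hfA, hpow _ _ hx0 h2, hpow _ _ hy0 h2]; norm_num
end part7

section part8
variable {F : Type} [Field F] [Fintype F] [DecidableEq F]

lemma cheb_key (l p : ℕ) (hl : l.Prime) (hl4 : l % 4 = 1)
    (hp : p.Prime) (hp4 : p % 4 = 1) (hne : p ≠ l)
    (hord : orderOf (p : ZMod l) = l - 1) (a : ℕ) (ha : 1 ≤ a)
    (hcard : Fintype.card F = p ^ (2 * a)) :
    chebAffineCount F l = (p ^ a) ^ 2 + (l - 1) * p ^ a ↔
      ∃ b, Odd b ∧ 0 < b ∧ a = b * ((l - 1) / 2) := by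
  have hfl : Fact l.Prime := ⟨hl⟩
  have hl5 : 5 ≤ l := by
    have := hl.two_le
    omega
  have hlodd : Odd l := Nat.odd_iff.mpr (by omega)
  have hQ8 : Fintype.card F % 8 = 1 := by rw [hcard]; exact cheb_pow_card8 p a hp4
  have hF := cheb_ringChar hQ8
  have hcnt := cheb_count hF l
  have hev := cheb_S_even hQ8 l hlodd
  obtain ⟨Bl, B1, hS, h0, hA1, hA2, hB1, hB2⟩ := cheb_split hF l hl
  set S : ℤ := ∑ x : F, quadraticChar F ((dickson 1 (1 : F) l).eval x) with hSdef
  obtain ⟨hm1, hm2⟩ := cheb_A1_mod_l (F := F) l p a hl hl4 hp hp4 hne ha hcard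
  have hqq : p ^ (2 * a) = (p ^ a) ^ 2 := by rw [mul_comm, pow_mul]
  have hqpos : 0 < p ^ a := pow_pos hp.pos a
  have hiff : chebAffineCount F l = (p ^ a) ^ 2 + (l - 1) * p ^ a ↔
      S = ((l : ℤ) - 1) * (p : ℤ) ^ a := by
    rw [← Nat.cast_inj (R := ℤ), hcnt, hcard, hqq]
    push_cast [Nat.cast_sub (show 1 ≤ l by omega)]
    constructor <;> intro h <;> linarith
  rw [hiff]
  have hone : ∀ n, (p : ZMod l) ^ n = 1 ↔ l - 1 ∣ n := by
    intro n; rw [← hord, orderOf_dvd_iff_pow_eq_one]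
  have h2 : (2 : ZMod l) ≠ 0 := by
    intro h
    have h' : ((2 : ℕ) : ZMod l) = 0 := by exact_mod_cast h
    rw [ZMod.natCast_eq_zero_iff] at h'
    have := Nat.le_of_dvd (by norm_num) h'
    omega
  have hp0 : (p : ZMod l) ≠ 0 := by
    rw [Ne, ZMod.natCast_eq_zero_iff]
    intro h
    exact hne ((Nat.prime_dvd_prime_iff_eq hl hp).mp h).symm
  have hdm : l ∣ Fintype.card F - 1 ↔ (p : ZMod l) ^ (2 * a) = 1 := by
    rw [← ZMod.natCast_eq_zero_iff, Nat.cast_sub (Fintype.card_pos), hcard, sub_eq_zero]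
    push_cast; rfl
  have hdp : l ∣ Fintype.card F + 1 ↔ (p : ZMod l) ^ (2 * a) = -1 := by
    rw [← ZMod.natCast_eq_zero_iff, hcard]
    push_cast
    rw [add_eq_zero_iff_eq_neg]
  have hcast0 : ∀ z : ℤ, (l : ℤ) ∣ z → (z : ZMod l) = 0 := fun z hz =>
    (ZMod.intCast_zmod_eq_zero_iff_dvd z l).mpr hz
  -- the case `Q = 1`
  have hcase1 : (p : ZMod l) ^ (2 * a) = 1 →
      2 * S = chebA F l - chebA F 1 ∧ (S : ZMod l) = 1 := by
    intro h
    have hnp : ¬ l ∣ Fintype.card F + 1 := by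
      rw [hdp, h]
      intro h'
      apply h2
      linear_combination h'
    have e1 : 2 * S = chebA F l - chebA F 1 := by
      rw [hS, hB1 hnp]; linarith
    refine ⟨e1, ?_⟩
    have e2 := congrArg (Int.cast : ℤ → ZMod l) e1
    push_cast at e2
    rw [hcast0 _ (hA2 (hdm.mpr h)), hm2 ((hone _).mp h)] at e2
    have e3 : (2 : ZMod l) * ((S : ZMod l) - 1) = 0 := by linear_combination e2
    exact sub_eq_zero.mp ((mul_eq_zero.mp e3).resolve_left h2)
  constructor
  · intro hmax
    have hSl : (S : ZMod l) = -(p : ZMod l) ^ a := by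
      rw [hmax]; push_cast; simp
    by_cases h4 : (p : ZMod l) ^ (4 * a) = 1
    · have hsq : ((p : ZMod l) ^ (2 * a)) ^ 2 = 1 ^ 2 := by
        rw [← pow_mul, one_pow, ← h4]; congr 1; ring
      rcases sq_eq_sq_iff_eq_or_eq_neg.mp hsq with h | h
      · obtain ⟨-, hS1⟩ := hcase1 h
        have hna : ¬ l - 1 ∣ a := by
          rw [← hone]
          intro h'
          rw [hSl, h'] at hS1
          apply h2
          linear_combination -hS1
        obtain ⟨b, hb⟩ := (hone _).mp h
        have hbodd : Odd b := by
          by_contra hb'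
          obtain ⟨c, hc⟩ := Nat.not_odd_iff_even.mp hb'
          apply hna
          refine ⟨c, ?_⟩
          have : 2 * a = 2 * ((l - 1) * c) := by rw [hb, hc]; ring
          omega
        refine ⟨b, hbodd, hbodd.pos, ?_⟩
        obtain ⟨n, hn⟩ : ∃ n, l - 1 = 2 * n := ⟨(l - 1) / 2, by omega⟩
        rw [hn] at hb ⊢
        rw [Nat.mul_div_cancel_left _ (by norm_num)]
        have : 2 * a = 2 * (b * n) := by rw [hb]; ring
        omega
      · exfalso
        have hnm : ¬ l ∣ Fintype.card F - 1 := by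
          rw [hdm, h]
          intro h'
          apply h2
          linear_combination -h'
        have e2 := congrArg (Int.cast : ℤ → ZMod l) hS
        push_cast at e2
        rw [hcast0 _ (hB2 (hdp.mpr h)), hA1 hnm, hm1 h ((hone _).mp h4), hSl, add_zero] at e2
        have : (p : ZMod l) ^ a ≠ 0 := pow_ne_zero _ hp0
        have e3 : (2 : ZMod l) * (p : ZMod l) ^ a = 0 := by linear_combination -e2
        rcases mul_eq_zero.mp e3 with h5 | h5
        · exact h2 h5
        · exact this h5
    · exfalso
      have hp4a : (p : ZMod l) ^ (4 * a) = ((p : ZMod l) ^ (2 * a)) ^ 2 := by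
        rw [← pow_mul]; congr 1; ring
      have hnm : ¬ l ∣ Fintype.card F - 1 := by
        rw [hdm]; intro h; apply h4; rw [hp4a, h, one_pow]
      have hnp : ¬ l ∣ Fintype.card F + 1 := by
        rw [hdp]; intro h; apply h4; rw [hp4a, h]; norm_num
      rw [hA1 hnm, hB1 hnp, ← h0] at hS
      have hS0 : S = 0 := by omega
      rw [hS0] at hmax
      have e1 : (0 : ℤ) < (l : ℤ) - 1 := by omega
      have e2 : (0 : ℤ) < (p : ℤ) ^ a := by exact_mod_cast hqpos
      have := mul_pos e1 e2
      omega
  · rintro ⟨b, hbodd, hb0, hab⟩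
    have h2ab : 2 * a = b * (l - 1) := by
      obtain ⟨n, hn⟩ : ∃ n, l - 1 = 2 * n := ⟨(l - 1) / 2, by omega⟩
      rw [hn] at hab ⊢
      rw [Nat.mul_div_cancel_left _ (by norm_num)] at hab
      rw [hab]; ring
    have hQ1 : (p : ZMod l) ^ (2 * a) = 1 := (hone _).mpr ⟨b, by rw [h2ab]; ring⟩
    obtain ⟨h2S, hS1⟩ := hcase1 hQ1
    have hlQ : l ∣ Fintype.card F - 1 := hdm.mpr hQ1
    have hdvd : 4 * l ∣ Fintype.card F - 1 := by
      apply Nat.Coprime.mul_dvd_of_dvd_of_dvd _ (by omega) hlQ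
      rw [show 4 = 2 ^ 2 by norm_num]
      exact Nat.Coprime.pow_left 2 (Nat.coprime_two_left.mpr hlodd)
    have hbd := cheb_bound hF l (p ^ a) hlodd (by rw [hcard, hqq]) hdvd
    have hdd := cheb_dvd_diff (F := F) l p hl hl4 hp hp4 hord a b h2ab ha
      (by rw [← hcard]; exact hlQ) hcard
    rw [← h2S] at hbd hdd
    set q : ℤ := (p : ℤ) ^ a with hq
    have hqodd : Odd q := by
      apply Odd.pow
      exact_mod_cast Nat.odd_iff.mpr (show p % 2 = 1 by omega)
    have hqpos' : 0 < q := by rw [hq]; exact_mod_cast hqpos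
    have hcop : IsCoprime q 2 := by
      obtain ⟨k, hk⟩ := hqodd
      exact ⟨1, -k, by rw [hk]; ring⟩
    obtain ⟨m, hm⟩ := hcop.dvd_of_dvd_mul_left hdd
    have hmeven : Even m := by
      have h5 : Even (q * m) := by rw [← hm]; exact even_iff_two_dvd.mpr hev
      rcases Int.even_mul.mp h5 with h | h
      · exact absurd h (Int.not_even_iff_odd.mpr hqodd)
      · exact h
    have hqm1 : (p : ZMod l) ^ a = -1 := by
      have hsq : ((p : ZMod l) ^ a) ^ 2 = 1 ^ 2 := by
        rw [← pow_mul, one_pow, ← hQ1]; congr 1; ring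
      rcases sq_eq_sq_iff_eq_or_eq_neg.mp hsq with h | h
      · exfalso
        obtain ⟨c, hc⟩ := (hone _).mp h
        rw [hc] at h2ab
        have : (l - 1) * (2 * c) = (l - 1) * b := by linarith
        have := Nat.eq_of_mul_eq_mul_left (by omega) this
        obtain ⟨d, hd⟩ := hbodd
        omega
      · exact h
    have hml : (l : ℤ) ∣ m + 1 := by
      rw [← ZMod.intCast_zmod_eq_zero_iff_dvd]
      rw [hm] at hS1
      push_cast [hq] at hS1 ⊢
      rw [hqm1] at hS1
      linear_combination -hS1
    have hmb : |m| ≤ (l : ℤ) - 1 := by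
      rw [hm, abs_mul, abs_mul, abs_of_pos hqpos'] at hbd
      push_cast at hbd
      rw [← hq] at hbd
      have : q * (2 * |m|) ≤ q * (2 * ((l : ℤ) - 1)) := by
        have e : |(2 : ℤ)| = 2 := abs_two
        rw [e] at hbd
        linarith
      have := le_of_mul_le_mul_left this hqpos'
      linarith
    rw [abs_le] at hmb
    obtain ⟨c, hc⟩ := hml
    obtain ⟨d, hd⟩ := hmeven
    have hl5' : (5 : ℤ) ≤ l := by exact_mod_cast hl5
    have hc0 : 0 ≤ c := by
      by_contra hneg
      have : c ≤ -1 := by omega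
      nlinarith
    have hc1 : c ≤ 1 := by
      by_contra hneg
      have : 2 ≤ c := by omega
      nlinarith
    have hm' : m = (l : ℤ) - 1 := by
      have h8 : c = 0 ∨ c = 1 := by omega
      rcases h8 with h | h
      · rw [h] at hc; omega
      · rw [h] at hc; omega
    rw [hm, hm', mul_comm]
end part8

theorem statement5 (l p : ℕ) (hl : l.Prime) (hl4 : l % 4 = 1)
    (hp : p.Prime) (hp4 : p % 4 = 1) (hne : p ≠ l)
    (u : (ZMod l)ˣ) (hu : (u : ZMod l) = (p : ZMod l))
    (hprim : ∀ x : (ZMod l)ˣ, x ∈ Subgroup.zpowers u)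
    (a : ℕ) (ha : 1 ≤ a) :
    chebMaximal l (p ^ a) ↔ ∃ b, Odd b ∧ 0 < b ∧ a = b * ((l - 1) / 2) := by
  classical
  have hfl : Fact l.Prime := ⟨hl⟩
  have hfp : Fact p.Prime := ⟨hp⟩
  have hord : orderOf (p : ZMod l) = l - 1 := by
    rw [← hu, orderOf_units, orderOf_eq_card_of_forall_mem_zpowers hprim,
      Nat.card_eq_fintype_card, ZMod.card_units]
  have hqq : (p ^ a) ^ 2 = p ^ (2 * a) := by rw [mul_comm, pow_mul]
  constructor
  · intro h
    let F := GaloisField p (2 * a)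
    let hFf : Fintype F := Fintype.ofFinite F
    have hcard : Fintype.card F = p ^ (2 * a) := by
      rw [← Nat.card_eq_fintype_card]
      exact GaloisField.card p (2 * a) (by omega)
    exact (cheb_key (F := F) l p hl hl4 hp hp4 hne hord a ha hcard).mp
      (h F (by rw [hcard, hqq]))
  · intro h F _ _ hcard
    exact (cheb_key (F := F) l p hl hl4 hp hp4 hne hord a ha (by rw [hcard, hqq])).mpr h
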